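/- arXiv:2210.06415 — 2 statements merged into one kernel-verified Lean document; each statement's English description precedes it below -/
import Mathlib

section
/- Let a > 0 and 0 < h < a/2, and let [Δ, ((a,h)), (+1)] be the minimal semitoric polygon of type (1): Δ is the triangle with vertices (0,0), (a, a/2), (2a, 0), with one marked point at (a, h) and upward cut. Then the semitoric packing density is ρ_ST = (a² + 2h² − 2ah)/a². In particular 1/2 < ρ_ST < 1. -/
open Matrix MeasureTheory Set

/-- Points of the plane. -/
abbrev Pt := Fin 2 → ℝ

/-- The action of `SL₂(ℤ)` on `ℝ²` by matrix-vector multiplication. -/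
noncomputable def sl2Apply (M : Matrix.SpecialLinearGroup (Fin 2) ℤ) (x : Pt) : Pt :=
  ((M : Matrix (Fin 2) (Fin 2) ℤ).map (Int.cast : ℤ → ℝ)).mulVec x

/-- The model triangle `B(λ) = {(x,y) : x ≥ 0, y ≥ 0, x + y < λ}`. -/
def modelTriangle (lam : ℝ) : Set Pt :=
  {x | 0 ≤ x 0 ∧ 0 ≤ x 1 ∧ x 0 + x 1 < lam}

/-- The area (Lebesgue measure) of a subset of the plane. -/
noncomputable def area (S : Set Pt) : ℝ := (volume S).toReal

/-- The element of the group `𝒯 × G_m` determined by a global power `n` of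
`T = [[1,0],[1,1]]`, a vertical translation `t`, and cut flips `u` (with `u j ∈ {0, ε_j}`;
flipping the cut at the marked point `c j` applies `T^{± 1}` on the half-plane to its
right), as a piecewise affine map of the plane. -/
noncomputable def stMap {m : ℕ} (c : Fin m → Pt) (n : ℤ) (t : ℝ) (u : Fin m → ℤ)
    (x : Pt) : Pt :=
  ![x 0, x 1 + (n : ℝ) * x 0 + t + ∑ j, (u j : ℝ) * max (x 0 - c j 0) 0]

/-- `B` is an admissibly packed triangle of `SL₂(ℤ)`-size `lam` at the point `p` of the
semitoric polygon with underlying set `Δ`, marked points `c` and cut directions `eps`: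
in some equivalent representative (image under an element `σ` of `𝒯 × G_m`), `σ(B)` has
the form `M(B(lam)) + σ(p)` with `M ∈ SL₂(ℤ)`, coincides with the polygon near `σ(p)`,
and contains no marked point. -/
def IsSTPackedTriangleIn {m : ℕ} (Δ : Set Pt) (c : Fin m → Pt) (eps : Fin m → ℤ)
    (p : Pt) (lam : ℝ) (B : Set Pt) : Prop :=
  0 < lam ∧ B ⊆ Δ ∧ (∀ j, c j ∉ B) ∧
  ∃ (n : ℤ) (t : ℝ) (u : Fin m → ℤ), (∀ j, u j = 0 ∨ u j = eps j) ∧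
    (∃ M : Matrix.SpecialLinearGroup (Fin 2) ℤ,
        stMap c n t u '' B =
          (fun x => sl2Apply M x + stMap c n t u p) '' modelTriangle lam) ∧
    ∃ U : Set Pt, IsOpen U ∧ stMap c n t u p ∈ U ∧
      (stMap c n t u '' B) ∩ U = (stMap c n t u '' Δ) ∩ U

/-- `P` is a semitoric packing of the semitoric polygon `(Δ, c, eps)`: a finite union of
pairwise disjoint admissibly packed triangles, at most one at each vertex. -/
def IsSTPackingIn {m : ℕ} (Δ : Set Pt) (c : Fin m → Pt) (eps : Fin m → ℤ)
    (P : Set Pt) : Prop :=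
  ∃ (N : ℕ) (pt : Fin N → Pt) (lam : Fin N → ℝ) (tri : Fin N → Set Pt),
    P = (⋃ a, tri a) ∧ Function.Injective pt ∧
    (∀ a, pt a ∈ Set.extremePoints ℝ Δ) ∧
    (∀ a, IsSTPackedTriangleIn Δ c eps (pt a) (lam a) (tri a)) ∧
    Pairwise (Function.onFun Disjoint tri)

/-- The set of densities `area P / area Δ` of semitoric packings `P` of `(Δ, c, eps)`;
the semitoric packing density `ρ_ST` is its supremum. -/
def stDensitySet {m : ℕ} (Δ : Set Pt) (c : Fin m → Pt) (eps : Fin m → ℤ) : Set ℝ :=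
  {r : ℝ | ∃ P, IsSTPackingIn Δ c eps P ∧ r = area P / area Δ}

theorem measurePreserving_shear {f : ℝ → ℝ} (hf : Measurable f) :
    MeasurePreserving (fun x : Pt => (![x 0, x 1 + f (x 0)] : Pt)) := by
  have h1 : MeasurePreserving (fun z : ℝ × ℝ => (z.1, z.2 + f z.1)) (volume.prod volume)
      (volume.prod volume) :=
    (MeasurePreserving.id volume).skew_product (g := fun x y => y + f x)
      (measurable_snd.add (hf.comp measurable_fst))
      (Filter.Eventually.of_forall fun x => (measurePreserving_add_right volume (f x)).map_eq)
  have h2 := volume_preserving_finTwoArrow ℝ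
  exact (h2.symm.comp h1).comp h2

theorem measurePreserving_reflect (b : ℝ) :
    MeasurePreserving (fun x : Pt => (![b - x 0, x 1] : Pt)) := by
  have h1 : MeasurePreserving (fun z : ℝ × ℝ => (b - z.1, z.2)) (volume.prod volume)
      (volume.prod volume) :=
    (Measure.measurePreserving_sub_left volume b).prod (MeasurePreserving.id volume)
  have h2 := volume_preserving_finTwoArrow ℝ
  exact (h2.symm.comp h1).comp h2

/-- A planar set whose horizontal slices have lengths decreasing linearly from height `0` to
height `c` has the area of the corresponding triangle. -/
theorem volume_of_linear_slices {S : Set Pt} (hS : MeasurableSet S) {k c : ℝ} (hk : 0 ≤ k)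
    (hc : 0 ≤ c) (hneg : ∀ x ∈ S, 0 ≤ x 1)
    (hslice : ∀ y, 0 ≤ y → volume {x : ℝ | ![x, y] ∈ S} = ENNReal.ofReal (k * (c - y))) :
    volume S = ENNReal.ofReal (k * c ^ 2 / 2) := by
  have h2 := (volume_preserving_finTwoArrow ℝ).symm
  rw [← h2.measure_preimage hS.nullMeasurableSet]
  have hm := h2.measurable hS
  have hvol : (volume : Measure (ℝ × ℝ)) = volume.prod volume := rfl
  rw [hvol, Measure.prod_apply_symm hm]
  have hfun : (fun y : ℝ => volume ((fun x : ℝ => (x, y)) ⁻¹'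
      ((MeasurableEquiv.finTwoArrow (α := ℝ)).symm ⁻¹' S))) =
      (Set.Icc 0 c).indicator (fun y => ENNReal.ofReal (k * (c - y))) := by
    funext y
    have hset : ((fun x : ℝ => (x, y)) ⁻¹' ((MeasurableEquiv.finTwoArrow (α := ℝ)).symm ⁻¹' S))
        = {x : ℝ | ![x, y] ∈ S} := rfl
    rw [hset]
    by_cases hy : 0 ≤ y
    · rw [hslice y hy]
      by_cases hyc : y ≤ c
      · rw [Set.indicator_of_mem (Set.mem_Icc.2 ⟨hy, hyc⟩)]
      · rw [Set.indicator_of_notMem (fun h => hyc h.2), ENNReal.ofReal_eq_zero]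
        exact mul_nonpos_of_nonneg_of_nonpos hk (by linarith)
    · rw [Set.indicator_of_notMem (fun h => hy h.1)]
      have : {x : ℝ | ![x, y] ∈ S} = ∅ :=
        Set.eq_empty_of_forall_notMem fun x hx => hy (by simpa using hneg _ hx)
      rw [this, measure_empty]
  rw [hfun, lintegral_indicator measurableSet_Icc, ← ofReal_integral_eq_lintegral_ofReal]
  · congr 1
    rw [integral_Icc_eq_integral_Ioc, ← intervalIntegral.integral_of_le hc]
    have : ∀ y ∈ Set.uIcc 0 c,
        HasDerivAt (fun y : ℝ => -(k * (c - y) ^ 2 / 2)) (k * (c - y)) y := by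
      intro y _
      have := ((((hasDerivAt_id y).const_sub c).pow 2).const_mul k).div_const 2 |>.neg
      refine this.congr_deriv ?_
      simp
      ring
    rw [intervalIntegral.integral_eq_sub_of_hasDerivAt this
      (Continuous.intervalIntegrable (by fun_prop) _ _)]
    ring
  · exact Continuous.integrableOn_Icc (by fun_prop)
  · filter_upwards [ae_restrict_mem measurableSet_Icc] with y hy
    exact mul_nonneg hk (by linarith [hy.2])

/-- The triangle with vertices `(0, 0)`, `(a, a / 2)` and `(2 * a, 0)`. -/
def isoscelesTriangle (a : ℝ) : Set Pt :=
  {x | 0 ≤ x 1 ∧ 2 * x 1 ≤ x 0 ∧ 2 * x 1 ≤ 2 * a - x 0}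

/-- The triangle of size `lam` packed at the vertex `(0, 0)`. -/
def leftTri (a lam : ℝ) : Set Pt :=
  {x | x ∈ isoscelesTriangle a ∧ min (x 0) a - x 1 < lam}

/-- The triangle of size `lam` packed at the vertex `(2 * a, 0)`. -/
def rightTri (a lam : ℝ) : Set Pt :=
  {x | x ∈ isoscelesTriangle a ∧ min (2 * a - x 0) a - x 1 < lam}

theorem convexHull_eq_isoscelesTriangle {a : ℝ} (ha : 0 < a) :
    convexHull ℝ {![0, 0], ![a, a / 2], ![2 * a, 0]} = isoscelesTriangle a := by
  apply Set.Subset.antisymm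
  · refine convexHull_min ?_ ?_
    · rintro x (rfl | rfl | rfl) <;> refine ⟨?_, ?_, ?_⟩ <;> simp <;> linarith
    · intro x hx y hy s t hs ht hst
      obtain ⟨h1, h2, h3⟩ := hx
      obtain ⟨k1, k2, k3⟩ := hy
      refine ⟨?_, ?_, ?_⟩ <;> simp only [Pi.add_apply, Pi.smul_apply, smul_eq_mul] <;>
        nlinarith
  · rintro x ⟨h1, h2, h3⟩
    rw [convexHull_insert (by simp), convexHull_pair]
    simp only [mem_convexJoin, mem_singleton_iff, exists_eq_left]
    rcases le_or_gt (x 0 + 2 * x 1) 0 with h0 | h0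
    · refine ⟨![a, a / 2], left_mem_segment _ _ _, ?_⟩
      have : x = ![0, 0] := by
        ext i; fin_cases i <;> simp <;> linarith
      rw [this]
      exact left_mem_segment _ _ _
    · obtain ⟨b, hb⟩ : ∃ b, x 0 = b - 2 * x 1 := ⟨x 0 + 2 * x 1, by ring⟩
      have hb0 : 0 < b := by linarith
      refine ⟨![2 * a * x 0 / b, 2 * a * x 1 / b],
        ⟨4 * x 1 / b, 1 - 4 * x 1 / b, by positivity, ?_, by ring, ?_⟩,
        ⟨1 - b / (2 * a), b / (2 * a), ?_, by positivity, by ring, ?_⟩⟩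
      · rw [sub_nonneg, div_le_one hb0]; linarith
      · ext i; fin_cases i <;> simp [hb] <;> field_simp <;> ring
      · rw [sub_nonneg, div_le_one (by positivity)]; linarith
      · ext i; fin_cases i <;> simp <;> field_simp

theorem measurableSet_isoscelesTriangle (a : ℝ) : MeasurableSet (isoscelesTriangle a) := by
  unfold isoscelesTriangle
  measurability

theorem measurableSet_leftTri (a lam : ℝ) : MeasurableSet (leftTri a lam) :=
  (measurableSet_isoscelesTriangle a).inter
    (measurableSet_lt (f := fun x : Pt => min (x 0) a - x 1) (by fun_prop) measurable_const)

theorem measurableSet_rightTri (a lam : ℝ) : MeasurableSet (rightTri a lam) :=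
  (measurableSet_isoscelesTriangle a).inter
    (measurableSet_lt (f := fun x : Pt => min (2 * a - x 0) a - x 1) (by fun_prop)
      measurable_const)

theorem volume_isoscelesTriangle {a : ℝ} (ha : 0 < a) :
    volume (isoscelesTriangle a) = ENNReal.ofReal (a ^ 2 / 2) := by
  rw [volume_of_linear_slices (measurableSet_isoscelesTriangle a) (k := 4) (c := a / 2)
    (by norm_num) (by positivity) (fun x hx => hx.1)]
  · congr 1; ring
  · intro y hy
    have : {x : ℝ | ![x, y] ∈ isoscelesTriangle a} = Set.Icc (2 * y) (2 * a - 2 * y) := by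
      ext x
      simp only [isoscelesTriangle, mem_ofPred_eq, mem_Icc]
      simp
      constructor
      · rintro ⟨_, h1, h2⟩; constructor <;> linarith
      · rintro ⟨h1, h2⟩; refine ⟨hy, ?_, ?_⟩ <;> linarith
    rw [this, Real.volume_Icc]
    congr 1; ring

theorem volume_leftTri {a lam : ℝ} (h0 : 0 ≤ lam) (hl : lam ≤ a) :
    volume (leftTri a lam) = ENNReal.ofReal (lam ^ 2 / 2) := by
  set T : Set Pt := {x | 0 ≤ x 1 ∧ 2 * x 1 ≤ x 0 ∧ x 0 - x 1 < lam} with hT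
  have hTm : MeasurableSet T := by
    rw [hT]; measurability
  have hpre : leftTri a lam =
      (fun x : Pt => (![x 0, x 1 + max (x 0 - a) 0] : Pt)) ⁻¹' T := by
    ext x
    simp only [leftTri, isoscelesTriangle, hT, mem_ofPred_eq, mem_preimage]
    simp
    rcases le_total (x 0) a with hx | hx
    · rw [min_eq_left hx, max_eq_right (by linarith)]
      constructor
      · rintro ⟨⟨_, _, _⟩, _⟩; refine ⟨?_, ?_, ?_⟩ <;> linarith
      · rintro ⟨_, _, _⟩; refine ⟨⟨?_, ?_, ?_⟩, ?_⟩ <;> linarith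
    · rw [min_eq_right hx, max_eq_left (by linarith)]
      constructor
      · rintro ⟨⟨_, _, _⟩, _⟩; refine ⟨?_, ?_, ?_⟩ <;> linarith
      · rintro ⟨_, _, _⟩; refine ⟨⟨?_, ?_, ?_⟩, ?_⟩ <;> linarith
  rw [hpre, (measurePreserving_shear (f := fun s => max (s - a) 0) (by fun_prop)).measure_preimage
    hTm.nullMeasurableSet, volume_of_linear_slices hTm (k := 1) (c := lam) zero_le_one h0
    (fun x hx => hx.1)]
  · congr 1; ring
  · intro y hy
    have : {x : ℝ | ![x, y] ∈ T} = Set.Ico (2 * y) (lam + y) := by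
      ext x
      simp only [hT, mem_ofPred_eq, mem_Ico]
      simp
      constructor
      · rintro ⟨_, h1, h2⟩; constructor <;> linarith
      · rintro ⟨h1, h2⟩; refine ⟨hy, ?_, ?_⟩ <;> linarith
    rw [this, Real.volume_Ico]
    congr 1; ring

theorem volume_rightTri {a lam : ℝ} (h0 : 0 ≤ lam) (hl : lam ≤ a) :
    volume (rightTri a lam) = ENNReal.ofReal (lam ^ 2 / 2) := by
  have hpre : rightTri a lam = (fun x : Pt => (![2 * a - x 0, x 1] : Pt)) ⁻¹' leftTri a lam := by
    ext x
    simp only [leftTri, rightTri, isoscelesTriangle, mem_ofPred_eq, mem_preimage]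
    simp
    tauto
  rw [hpre, (measurePreserving_reflect (2 * a)).measure_preimage
    (measurableSet_leftTri a lam).nullMeasurableSet, volume_leftTri h0 hl]

theorem stMap_injective {m : ℕ} (c : Fin m → Pt) (n : ℤ) (t : ℝ) (u : Fin m → ℤ) :
    Function.Injective (stMap c n t u) := by
  intro x y hxy
  have h0 : x 0 = y 0 := by simpa [stMap] using congrFun hxy 0
  have h1 := congrFun hxy 1
  simp only [stMap, h0, cons_val_one, cons_val_fin_one, add_left_inj] at h1
  ext i
  fin_cases i
  · exact h0
  · exact h1

theorem continuous_stMap {m : ℕ} (c : Fin m → Pt) (n : ℤ) (t : ℝ) (u : Fin m → ℤ) :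
    Continuous (stMap c n t u) := by
  refine continuous_pi fun i => ?_
  fin_cases i
  · simpa [stMap] using continuous_apply (0 : Fin 2)
  · simp only [stMap]
    simp
    fun_prop

theorem sl2Apply_apply (M : Matrix.SpecialLinearGroup (Fin 2) ℤ) (x : Pt) :
    sl2Apply M x = ![M 0 0 * x 0 + M 0 1 * x 1, M 1 0 * x 0 + M 1 1 * x 1] := by
  ext i
  fin_cases i <;> simp [sl2Apply, Matrix.mulVec, dotProduct, Fin.sum_univ_two]

theorem sl2Apply_mk (A : Matrix (Fin 2) (Fin 2) ℤ) (hA : A.det = 1) (x : Pt) :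
    sl2Apply ⟨A, hA⟩ x = ![A 0 0 * x 0 + A 0 1 * x 1, A 1 0 * x 0 + A 1 1 * x 1] :=
  sl2Apply_apply ⟨A, hA⟩ x

/-- The height of `x` above `p` after applying the element of `𝒯 × G_1` given by `n` and `u`. -/
noncomputable def relHeight (c p : Pt) (n u : ℤ) (x : Pt) : ℝ :=
  x 1 - p 1 + n * (x 0 - p 0) + u * (max (x 0 - c 0) 0 - max (p 0 - c 0) 0)

/-- Coordinate form of admissible packing in the case of one marked point. -/
theorem IsSTPackedTriangleIn.exists_coords {Δ : Set Pt} {c p : Pt} {lam : ℝ} {B : Set Pt}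
    (hB : IsSTPackedTriangleIn Δ (![c] : Fin 1 → Pt) (![1] : Fin 1 → ℤ) p lam B) :
    ∃ n u k l r s : ℤ, (u = 0 ∨ u = 1) ∧ k * s - l * r = 1 ∧
      (∀ x, x ∈ B ↔ 0 ≤ s * (x 0 - p 0) - l * relHeight c p n u x ∧
        0 ≤ k * relHeight c p n u x - r * (x 0 - p 0) ∧
        (s * (x 0 - p 0) - l * relHeight c p n u x) +
          (k * relHeight c p n u x - r * (x 0 - p 0)) < lam) ∧
      ∃ V : Set Pt, IsOpen V ∧ p ∈ V ∧ ∀ x ∈ V, x ∈ B ↔ x ∈ Δ := by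
  obtain ⟨-, -, -, n, t, u, hu, ⟨M, hM⟩, U, hU, hpU, hBU⟩ := hB
  have hdet : M 0 0 * M 1 1 - M 0 1 * M 1 0 = 1 := by
    rw [← Matrix.det_fin_two, M.det_coe]
  have hdetR : (M 0 0 : ℝ) * M 1 1 - M 0 1 * M 1 0 = 1 := by exact_mod_cast hdet
  have hinj := stMap_injective (![c] : Fin 1 → Pt) n t u
  refine ⟨n, u 0, M 0 0, M 0 1, M 1 0, M 1 1, by simpa using hu 0, hdet, ?_, ?_⟩
  · intro x
    have e0 : stMap (![c] : Fin 1 → Pt) n t u x 0 = stMap ![c] n t u p 0 + (x 0 - p 0) := by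
      simp [stMap]
    have e1 : stMap (![c] : Fin 1 → Pt) n t u x 1 =
        stMap ![c] n t u p 1 + relHeight c p n (u 0) x := by
      simp [stMap, relHeight]
      ring
    rw [← hinj.mem_set_image, hM]
    generalize stMap (![c] : Fin 1 → Pt) n t u p = P at *
    generalize relHeight c p n (u 0) x = Y at *
    generalize stMap (![c] : Fin 1 → Pt) n t u x = Q at *
    generalize x 0 - p 0 = X at *
    constructor
    · rintro ⟨z, ⟨z0, z1, z2⟩, rfl⟩
      have f0 : X = M 0 0 * z 0 + M 0 1 * z 1 := by
        simp [sl2Apply_apply] at e0; linarith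
      have f1 : Y = M 1 0 * z 0 + M 1 1 * z 1 := by
        simp [sl2Apply_apply] at e1; linarith
      have g0 : M 1 1 * X - M 0 1 * Y = z 0 := by
        rw [f0, f1]; linear_combination z 0 * hdetR
      have g1 : M 0 0 * Y - M 1 0 * X = z 1 := by
        rw [f0, f1]; linear_combination z 1 * hdetR
      rw [g0, g1]
      exact ⟨z0, z1, z2⟩
    · rintro ⟨h0, h1, h2⟩
      refine ⟨![M 1 1 * X - M 0 1 * Y, M 0 0 * Y - M 1 0 * X], ⟨h0, h1, h2⟩, ?_⟩
      ext i
      fin_cases i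
      · simp [sl2Apply_apply, e0]
        linear_combination X * hdetR
      · simp [sl2Apply_apply, e1]
        linear_combination Y * hdetR
  · refine ⟨stMap ![c] n t u ⁻¹' U, hU.preimage (continuous_stMap _ _ _ _), hpU, ?_⟩
    intro x hx
    have := Set.ext_iff.1 hBU (stMap ![c] n t u x)
    simp only [mem_inter_iff, hinj.mem_set_image] at this
    have hx' : stMap ![c] n t u x ∈ U := hx
    tauto

theorem exists_small_step {V : Set Pt} (hV : IsOpen V) {p : Pt} (hp : p ∈ V) (d0 d1 e : ℝ)
    {m : ℝ} (hm : 0 < m) (e' : ℝ) {m' : ℝ} (hm' : 0 < m') :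
    ∃ t : ℝ, 0 < t ∧ ![p 0 + t * d0, p 1 + t * d1] ∈ V ∧ t * e < m ∧ t * e' < m' := by
  have hcont : Continuous fun t : ℝ => (![p 0 + t * d0, p 1 + t * d1] : Pt) := by
    refine continuous_pi fun i => ?_
    fin_cases i <;> simp <;> fun_prop
  have h1 : ∀ᶠ t in nhds (0 : ℝ), ![p 0 + t * d0, p 1 + t * d1] ∈ V := by
    refine hcont.continuousAt.eventually (hV.mem_nhds ?_)
    have : (![p 0 + 0 * d0, p 1 + 0 * d1] : Pt) = p := by
      ext i; fin_cases i <;> simp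
    simpa only [this] using hp
  have h2 : ∀ᶠ t in nhds (0 : ℝ), t * e < m :=
    (show Continuous fun t : ℝ => t * e by fun_prop).continuousAt.eventually_lt
      continuousAt_const (by simpa using hm)
  have h3 : ∀ᶠ t in nhds (0 : ℝ), t * e' < m' :=
    (show Continuous fun t : ℝ => t * e' by fun_prop).continuousAt.eventually_lt
      continuousAt_const (by simpa using hm')
  have h4 := ((h1.and (h2.and h3)).filter_mono nhdsWithin_le_nhds).and
    (self_mem_nhdsWithin (s := Set.Ioi (0 : ℝ)))
  obtain ⟨t, ⟨ht1, ht2, ht3⟩, ht0⟩ := h4.exists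
  exact ⟨t, ht0, ht1, ht2, ht3⟩

/-- A packed triangle and the polygon have the same tangent directions at the vertex. -/
theorem tangent_iff {Δ B V : Set Pt} {c p : Pt} {lam : ℝ} {n u k l r s : ℤ} (hlam : 0 < lam)
    (hB : ∀ x, x ∈ B ↔ 0 ≤ s * (x 0 - p 0) - l * relHeight c p n u x ∧
      0 ≤ k * relHeight c p n u x - r * (x 0 - p 0) ∧
      (s * (x 0 - p 0) - l * relHeight c p n u x) +
        (k * relHeight c p n u x - r * (x 0 - p 0)) < lam)
    (hV : IsOpen V) (hp : p ∈ V) (hBV : ∀ x ∈ V, x ∈ B ↔ x ∈ Δ) (d0 d1 e : ℝ) {m : ℝ}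
    (hm : 0 < m) {Q : Prop}
    (hd : ∀ t, 0 < t → t < m → relHeight c p n u ![p 0 + t * d0, p 1 + t * d1] = t * e ∧
      (![p 0 + t * d0, p 1 + t * d1] ∈ Δ ↔ Q)) :
    (0 ≤ s * d0 - l * e ∧ 0 ≤ k * e - r * d0) ↔ Q := by
  obtain ⟨t, ht, htV, htm, htl⟩ :=
    exists_small_step hV hp d0 d1 1 hm ((s * d0 - l * e) + (k * e - r * d0)) hlam
  obtain ⟨he, hQ⟩ := hd t ht (by linarith)
  rw [← hQ, ← hBV _ htV, hB, he]
  have e1 : (s : ℝ) * (t * d0) - l * (t * e) = t * (s * d0 - l * e) := by ring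
  have e2 : (k : ℝ) * (t * e) - r * (t * d0) = t * (k * e - r * d0) := by ring
  simp only [cons_val_zero, add_sub_cancel_left, e1, e2, ← mul_add, mul_nonneg_iff_of_pos_left ht]
  tauto

theorem mul_lt_of_lt_div_abs {a t d0 d1 : ℝ} (ht : 0 < t)
    (h : t < a / (|d0| + 2 * |d1| + 1)) : |t * d0| + 2 * |t * d1| < a := by
  rw [lt_div_iff₀ (by positivity)] at h
  rw [abs_mul, abs_mul, abs_of_pos ht]
  linarith

theorem IsSTPackedTriangleIn.eq_leftTri {a h lam : ℝ} {B : Set Pt} (ha : 0 < a) (hh1 : 0 < h)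
    (hh2 : h < a / 2)
    (hB : IsSTPackedTriangleIn (isoscelesTriangle a) (![![a, h]] : Fin 1 → Pt)
      (![1] : Fin 1 → ℤ) ![0, 0] lam B) :
    B = leftTri a lam ∧ lam ≤ a - h := by
  obtain ⟨n, u, k, l, r, s, hu, hdet, hc, V, hV, hpV, hBV⟩ := hB.exists_coords
  obtain ⟨hlam, hsub, hmark, -⟩ := hB
  have key : ∀ d0 d1 : ℝ, (0 ≤ s * d0 - l * (d1 + n * d0) ∧ 0 ≤ k * (d1 + n * d0) - r * d0) ↔
      (0 ≤ d1 ∧ 2 * d1 ≤ d0) := by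
    intro d0 d1
    refine tangent_iff hlam hc hV hpV hBV d0 d1 _ (m := a / (|d0| + 2 * |d1| + 1))
      (by positivity) fun t ht htm => ?_
    have hlt := mul_lt_of_lt_div_abs ht htm
    have h1 := le_abs_self (t * d0)
    have h2 := le_abs_self (t * d1)
    have h3 := abs_nonneg (t * d1)
    constructor
    · simp only [relHeight]
      simp
      rw [max_eq_right (by linarith), max_eq_right (by linarith)]
      ring
    · simp only [isoscelesTriangle, mem_ofPred_eq]
      simp
      have e1 : 2 * (t * d1) ≤ t * d0 ↔ 2 * d1 ≤ d0 := by
        rw [show 2 * (t * d1) = t * (2 * d1) by ring, mul_le_mul_iff_right₀ ht]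
      rw [e1, mul_nonneg_iff_of_pos_left ht]
      constructor
      · rintro ⟨h4, h5, -⟩; exact ⟨h4, h5⟩
      · rintro ⟨h4, h5⟩; exact ⟨h4, h5, by linarith⟩
  have hdetR : (k : ℝ) * s - l * r = 1 := by exact_mod_cast hdet
  have v1 := (key k (r - n * k)).1 ⟨by linarith, by linarith⟩
  have v2 := (key l (s - n * l)).1 ⟨by linarith, by linarith⟩
  have w1 := (key 1 0).2 (by norm_num)
  have w2 := (key 2 1).2 (by norm_num)
  have hr : (r : ℝ) = n * k := by linarith
  have hl : (l : ℝ) = 2 * (s - n * l) := by linarith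
  have hr' : r = n * k := by exact_mod_cast hr
  have hprod : k * (s - n * l) = 1 := by rw [hr'] at hdet; linarith
  have hs0 : 0 ≤ s - n * l := by exact_mod_cast v2.1
  obtain ⟨hk, hsl⟩ : k = 1 ∧ s - n * l = 1 := by
    rcases Int.mul_eq_one_iff_eq_one_or_neg_one.1 hprod with h1 | h1
    · exact h1
    · omega
  have hslR : (s : ℝ) - n * l = 1 := by exact_mod_cast hsl
  have hkR : (k : ℝ) = 1 := by exact_mod_cast hk
  have hlR : (l : ℝ) = 2 := by linarith
  have hrR : (r : ℝ) = n := by rw [hr, hkR, mul_one]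
  have hsR : (s : ℝ) = 2 * n + 1 := by rw [hlR] at hslR; linarith
  have hmem : ∀ x, x ∈ B ↔ 0 ≤ x 0 - 2 * (x 1 + u * max (x 0 - a) 0) ∧
      0 ≤ x 1 + u * max (x 0 - a) 0 ∧ x 0 - (x 1 + u * max (x 0 - a) 0) < lam := by
    intro x
    have eY : relHeight ![a, h] ![0, 0] n u x = x 1 + u * max (x 0 - a) 0 + n * x 0 := by
      simp [relHeight, ha.le]; ring
    rw [hc, eY, hkR, hlR, hrR, hsR]
    simp only [cons_val_zero]
    constructor <;> rintro ⟨h1, h2, h3⟩ <;> refine ⟨?_, ?_, ?_⟩ <;> linarith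
  have hBL : B = leftTri a lam := by
    ext x
    simp only [leftTri, mem_ofPred_eq]
    constructor
    · intro hx
      refine ⟨hsub hx, ?_⟩
      have hx' := (hmem x).1 hx
      rcases hu with rfl | rfl
      · have := min_le_left (x 0) a
        simp at hx'
        linarith [hx'.2.2]
      · have := min_add_max (x 0 - a) 0
        have := min_sub_sub_right (x 0) a a
        simp at this hx'
        linarith [hx'.2.2]
    · rintro ⟨⟨h1, h2, h3⟩, h4⟩
      rw [hmem]
      rcases le_total (x 0) a with hx | hx
      · rw [min_eq_left hx] at h4
        rw [max_eq_right (by linarith)]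
        refine ⟨?_, ?_, ?_⟩ <;> linarith
      · rw [min_eq_right hx] at h4
        rw [max_eq_left (by linarith)]
        rcases hu with rfl | rfl
        · exfalso
          have hb : a / 2 < lam := by linarith
          have hm' : a / 2 < min lam a := lt_min hb (by linarith)
          obtain ⟨z, hz1, hz2⟩ := exists_between hm'
          have hzl := hz2.trans_le (min_le_left _ _)
          have hz := hsub ((hmem ![2 * z, z]).2 (by simp; constructor <;> linarith))
          have := hz.2.2
          simp at this
          linarith
        · push_cast
          refine ⟨?_, ?_, ?_⟩ <;> linarith
  refine ⟨hBL, ?_⟩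
  by_contra hcon
  apply hmark 0
  rw [hBL]
  refine ⟨⟨?_, ?_, ?_⟩, ?_⟩ <;> simp <;> linarith

theorem IsSTPackedTriangleIn.eq_rightTri {a h lam : ℝ} {B : Set Pt} (ha : 0 < a) (hh1 : 0 < h)
    (hh2 : h < a / 2)
    (hB : IsSTPackedTriangleIn (isoscelesTriangle a) (![![a, h]] : Fin 1 → Pt)
      (![1] : Fin 1 → ℤ) ![2 * a, 0] lam B) :
    B = rightTri a lam ∧ lam ≤ a - h := by
  obtain ⟨n, u, k, l, r, s, hu, hdet, hc, V, hV, hpV, hBV⟩ := hB.exists_coords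
  obtain ⟨hlam, hsub, hmark, -⟩ := hB
  obtain ⟨N, hN⟩ : ∃ N : ℤ, N = n + u := ⟨_, rfl⟩
  have hnR : (n : ℝ) = N - u := by rw [hN]; push_cast; ring
  have key : ∀ d0 d1 : ℝ, (0 ≤ s * d0 - l * (d1 + N * d0) ∧ 0 ≤ k * (d1 + N * d0) - r * d0) ↔
      (0 ≤ d1 ∧ 2 * d1 ≤ -d0) := by
    intro d0 d1
    refine tangent_iff hlam hc hV hpV hBV d0 d1 _ (m := a / (|d0| + 2 * |d1| + 1))
      (by positivity) fun t ht htm => ?_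
    have hlt := mul_lt_of_lt_div_abs ht htm
    have h1 := neg_abs_le (t * d0)
    have h2 := le_abs_self (t * d1)
    have h3 := abs_nonneg (t * d1)
    constructor
    · simp only [relHeight]
      simp
      rw [max_eq_left (by linarith), max_eq_left (by linarith), hnR]
      ring
    · simp only [isoscelesTriangle, mem_ofPred_eq]
      simp
      have e1 : 2 * (t * d1) ≤ -(t * d0) ↔ 2 * d1 ≤ -d0 := by
        rw [show 2 * (t * d1) = t * (2 * d1) by ring, ← mul_neg, mul_le_mul_iff_right₀ ht]
      rw [e1, mul_nonneg_iff_of_pos_left ht]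
      constructor
      · rintro ⟨h4, -, h5⟩; exact ⟨h4, h5⟩
      · rintro ⟨h4, h5⟩; exact ⟨h4, by linarith, h5⟩
  have hdetR : (k : ℝ) * s - l * r = 1 := by exact_mod_cast hdet
  have v1 := (key k (r - N * k)).1 ⟨by linarith, by linarith⟩
  have v2 := (key l (s - N * l)).1 ⟨by linarith, by linarith⟩
  have w1 := (key (-1) 0).2 (by norm_num)
  have w2 := (key (-2) 1).2 (by norm_num)
  have hs : (s : ℝ) = N * l := by linarith
  have hk : (k : ℝ) = -2 * (r - N * k) := by linarith
  have hs' : s = N * l := by exact_mod_cast hs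
  have hprod : -l * (r - N * k) = 1 := by rw [hs'] at hdet; linarith
  have hr0 : 0 ≤ r - N * k := by exact_mod_cast v1.1
  obtain ⟨hl, hrk⟩ : -l = 1 ∧ r - N * k = 1 := by
    rcases Int.mul_eq_one_iff_eq_one_or_neg_one.1 hprod with h1 | h1
    · exact h1
    · omega
  have hrkR : (r : ℝ) - N * k = 1 := by exact_mod_cast hrk
  have hlR : (l : ℝ) = -1 := by
    have : l = -1 := by omega
    exact_mod_cast this
  have hkR : (k : ℝ) = -2 := by linarith
  have hsR : (s : ℝ) = -N := by rw [hs, hlR]; ring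
  have hrR : (r : ℝ) = 1 - 2 * N := by rw [hkR] at hrkR; linarith
  have hmem : ∀ x, x ∈ B ↔ 0 ≤ x 1 + u * max (a - x 0) 0 ∧
      0 ≤ 2 * a - x 0 - 2 * (x 1 + u * max (a - x 0) 0) ∧
      2 * a - x 0 - (x 1 + u * max (a - x 0) 0) < lam := by
    intro x
    have eY : relHeight ![a, h] ![2 * a, 0] n u x =
        x 1 + u * max (a - x 0) 0 + N * (x 0 - 2 * a) := by
      have h1 : max (x 0 - a) 0 = x 0 - a + max (a - x 0) 0 := by
        rcases le_total (x 0) a with hx | hx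
        · rw [max_eq_right (by linarith), max_eq_left (by linarith)]; ring
        · rw [max_eq_left (by linarith), max_eq_right (by linarith)]; ring
      have h2 : max (2 * a - a) 0 = a := by rw [max_eq_left (by linarith)]; ring
      simp only [relHeight, cons_val_zero, cons_val_one, cons_val_fin_one, h1, h2, hnR]
      ring
    rw [hc, eY, hkR, hlR, hrR, hsR]
    simp only [cons_val_zero]
    constructor <;> rintro ⟨h1, h2, h3⟩ <;> refine ⟨?_, ?_, ?_⟩ <;> linarith
  have hBR : B = rightTri a lam := by
    ext x
    simp only [rightTri, mem_ofPred_eq]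
    constructor
    · intro hx
      refine ⟨hsub hx, ?_⟩
      have hx' := (hmem x).1 hx
      rcases hu with rfl | rfl
      · have := min_le_left (2 * a - x 0) a
        simp at hx'
        linarith [hx'.2.2]
      · have h1 := min_add_max (a - x 0) 0
        have h2 := min_sub_sub_right (2 * a - x 0) a a
        rw [sub_self, show 2 * a - x 0 - a = a - x 0 by ring] at h2
        push_cast at hx'
        linarith [hx'.2.2]
    · rintro ⟨⟨h1, h2, h3⟩, h4⟩
      rw [hmem]
      rcases le_total a (x 0) with hx | hx
      · rw [min_eq_left (by linarith)] at h4
        rw [max_eq_right (by linarith)]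
        refine ⟨?_, ?_, ?_⟩ <;> linarith
      · rw [min_eq_right (by linarith)] at h4
        rw [max_eq_left (by linarith)]
        rcases hu with rfl | rfl
        · exfalso
          have hb : a / 2 < lam := by linarith
          have hm' : a / 2 < min lam a := lt_min hb (by linarith)
          obtain ⟨z, hz1, hz2⟩ := exists_between hm'
          have hzl := hz2.trans_le (min_le_left _ _)
          have hz := hsub ((hmem ![2 * a - 2 * z, z]).2
            (by simp; refine ⟨?_, ?_⟩ <;> linarith))
          have := hz.2.1
          simp at this
          linarith
        · push_cast
          refine ⟨?_, ?_, ?_⟩ <;> linarith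
  refine ⟨hBR, ?_⟩
  by_contra hcon
  apply hmark 0
  rw [hBR]
  refine ⟨⟨?_, ?_, ?_⟩, ?_⟩
  · simpa using hh1.le
  · simp; linarith
  · simp; linarith
  · have : min (2 * a - a) a = a := by rw [min_eq_right (by linarith)]
    simp [this]; linarith

/-- The top vertex of the triangle carries no packed triangle. -/
theorem not_isSTPackedTriangleIn_top {a h lam : ℝ} {B : Set Pt} (ha : 0 < a) :
    ¬ IsSTPackedTriangleIn (isoscelesTriangle a) (![![a, h]] : Fin 1 → Pt)
      (![1] : Fin 1 → ℤ) ![a, a / 2] lam B := by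
  intro hB
  obtain ⟨n, u, k, l, r, s, hu, hdet, hc, V, hV, hpV, hBV⟩ := hB.exists_coords
  obtain ⟨hlam, -⟩ := hB
  have key : ∀ d0 d1 : ℝ, (0 ≤ s * d0 - l * (d1 + n * d0 + u * max d0 0) ∧
      0 ≤ k * (d1 + n * d0 + u * max d0 0) - r * d0) ↔ (2 * d1 ≤ d0 ∧ 2 * d1 ≤ -d0) := by
    intro d0 d1
    refine tangent_iff hlam hc hV hpV hBV d0 d1 _ (m := (a / 2) / (|d0| + 2 * |d1| + 1))
      (by positivity) fun t ht htm => ?_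
    have hlt := mul_lt_of_lt_div_abs ht htm
    have h1 := neg_abs_le (t * d1)
    have h2 := abs_nonneg (t * d0)
    have h3 := abs_nonneg (t * d1)
    constructor
    · simp only [relHeight]
      simp
      rw [show max (t * d0) 0 = t * max d0 0 by rw [mul_max_of_nonneg _ _ ht.le, mul_zero]]
      ring
    · simp only [isoscelesTriangle, mem_ofPred_eq]
      simp
      have e1 : 2 * (a / 2 + t * d1) ≤ 2 * a - (a + t * d0) ↔ 2 * d1 ≤ -d0 := by
        rw [show 2 * d1 ≤ -d0 ↔ t * (2 * d1) ≤ t * (-d0) from (mul_le_mul_iff_right₀ ht).symm]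
        constructor <;> intro h4 <;> linarith
      have e2 : 2 * (a / 2 + t * d1) ≤ a + t * d0 ↔ 2 * d1 ≤ d0 := by
        rw [show 2 * d1 ≤ d0 ↔ t * (2 * d1) ≤ t * d0 from (mul_le_mul_iff_right₀ ht).symm]
        constructor <;> intro h4 <;> linarith
      rw [e1, e2]
      constructor
      · rintro ⟨-, h5⟩; exact h5
      · intro h5; exact ⟨by linarith, h5⟩
  have hdetR : (k : ℝ) * s - l * r = 1 := by exact_mod_cast hdet
  have w1 := (key 2 (-1)).2 (by norm_num)
  have w2 := (key (-2) (-1)).2 (by norm_num)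
  rw [max_eq_left (by norm_num : (0 : ℝ) ≤ 2)] at w1
  rw [max_eq_right (by norm_num : (-2 : ℝ) ≤ 0)] at w2
  rcases hu with rfl | rfl
  · have v1 := (key k (r - n * k)).1 (by push_cast; constructor <;> linarith)
    have v2 := (key l (s - n * l)).1 (by push_cast; constructor <;> linarith)
    push_cast at w1 w2
    have hk : (k : ℝ) = 2 * (r - n * k) := by linarith
    have hl : (l : ℝ) = -2 * (s - n * l) := by linarith
    have hk' : k = 2 * (r - n * k) := by exact_mod_cast hk
    have hl' : l = -2 * (s - n * l) := by exact_mod_cast hl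
    generalize r - n * k = ρ at hk'
    generalize s - n * l = τ at hl'
    subst hk' hl'
    have : 2 * (ρ * s + τ * r) = 1 := by linarith
    omega
  · push_cast at w1 w2
    have e1 : (2 : ℝ) * s = l * (2 * n + 1) := by linarith
    have e2 : (2 : ℝ) * r = k * (2 * n + 1) := by linarith
    have : (2 : ℝ) * (k * s - l * r) = 0 := by linear_combination (k : ℝ) * e1 - l * e2
    rw [hdetR] at this
    norm_num at this

theorem isSTPackedTriangleIn_leftTri {a h lam : ℝ} (h0 : 0 < lam) (hl : lam ≤ a - h)
    (hh1 : 0 < h) :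
    IsSTPackedTriangleIn (isoscelesTriangle a) (![![a, h]] : Fin 1 → Pt) (![1] : Fin 1 → ℤ)
      ![0, 0] lam (leftTri a lam) := by
  refine ⟨h0, fun x hx => hx.1, ?_, 0, 0, ![1], by simp, ⟨⟨!![1, 2; 0, 1], by simp⟩, ?_⟩,
    {x | x 0 - x 1 < lam}, isOpen_lt (by fun_prop) continuous_const, ?_, ?_⟩
  · intro j hj
    have := hj.2
    simp at this
    linarith
  · ext y
    constructor
    · rintro ⟨x, ⟨⟨h1, h2, h3⟩, h4⟩, rfl⟩
      refine ⟨![x 0 - 2 * (x 1 + max (x 0 - a) 0), x 1 + max (x 0 - a) 0], ⟨?_, ?_, ?_⟩, ?_⟩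
      · simp only [cons_val_zero]
        rcases le_total (x 0) a with hx | hx
        · rw [max_eq_right (by linarith)]; linarith
        · rw [max_eq_left (by linarith)]; linarith
      · have := le_max_right (x 0 - a) 0
        simp only [cons_val_one, cons_val_fin_one]
        linarith
      · simp only [cons_val_zero, cons_val_one, cons_val_fin_one]
        rcases le_total (x 0) a with hx | hx
        · rw [min_eq_left hx] at h4
          rw [max_eq_right (by linarith)]; linarith
        · rw [min_eq_right hx] at h4
          rw [max_eq_left (by linarith)]; linarith
      · ext i
        fin_cases i <;> simp [sl2Apply_mk, stMap]
        linarith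
    · rintro ⟨z, ⟨z0, z1, z2⟩, rfl⟩
      refine ⟨![z 0 + 2 * z 1, z 1 - max (z 0 + 2 * z 1 - a) 0], ⟨⟨?_, ?_, ?_⟩, ?_⟩, ?_⟩
      all_goals try simp only [cons_val_zero, cons_val_one, cons_val_fin_one]
      · rcases le_total (z 0 + 2 * z 1) a with hx | hx
        · rw [max_eq_right (by linarith)]; linarith
        · rw [max_eq_left (by linarith)]; linarith
      · have := le_max_right (z 0 + 2 * z 1 - a) 0
        linarith
      · have := le_max_left (z 0 + 2 * z 1 - a) 0
        linarith
      · rcases le_total (z 0 + 2 * z 1) a with hx | hx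
        · rw [max_eq_right (by linarith), min_eq_left hx]; linarith
        · rw [max_eq_left (by linarith), min_eq_right hx]; linarith
      · ext i
        have : max (-a) 0 = 0 := max_eq_right (by linarith)
        fin_cases i <;> simp [sl2Apply_mk, stMap, this]
  · have : max (-a) 0 = 0 := max_eq_right (by linarith)
    simp [stMap, this, h0]
  · ext y
    constructor
    · rintro ⟨⟨x, hx, rfl⟩, hy⟩
      exact ⟨⟨x, hx.1, rfl⟩, hy⟩
    · rintro ⟨⟨x, hx, rfl⟩, hy⟩
      refine ⟨⟨x, ⟨hx, ?_⟩, rfl⟩, hy⟩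
      simp [stMap] at hy
      have h1 := min_add_max (x 0 - a) 0
      have h2 := min_sub_sub_right (x 0) a a
      rw [sub_self] at h2
      linarith

theorem isSTPackedTriangleIn_rightTri {a h lam : ℝ} (h0 : 0 < lam) (hl : lam ≤ a - h)
    (hh1 : 0 < h) :
    IsSTPackedTriangleIn (isoscelesTriangle a) (![![a, h]] : Fin 1 → Pt) (![1] : Fin 1 → ℤ)
      ![2 * a, 0] lam (rightTri a lam) := by
  have ha : 0 < a := by linarith
  have htop : max (2 * a - a) 0 = a := by rw [max_eq_left (by linarith)]; ring
  refine ⟨h0, fun x hx => hx.1, ?_, 0, 0, ![1], by simp, ⟨⟨!![-2, -1; -1, -1], by simp⟩, ?_⟩,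
    {x | a - x 1 < lam}, isOpen_lt (by fun_prop) continuous_const, ?_, ?_⟩
  · intro j hj
    have := hj.2
    have h2 : min (2 * a - a) a = a := by rw [min_eq_right (by linarith)]
    simp [h2] at this
    linarith
  · ext y
    constructor
    · rintro ⟨x, ⟨⟨h1, h2, h3⟩, h4⟩, rfl⟩
      refine ⟨![x 1 + max (x 0 - a) 0 - x 0 + a, x 0 - 2 * (x 1 + max (x 0 - a) 0)],
        ⟨?_, ?_, ?_⟩, ?_⟩
      · have := le_max_left (x 0 - a) 0
        simp only [cons_val_zero]
        linarith
      · simp only [cons_val_one, cons_val_fin_one]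
        rcases le_total (x 0) a with hx | hx
        · rw [max_eq_right (by linarith)]; linarith
        · rw [max_eq_left (by linarith)]; linarith
      · simp only [cons_val_zero, cons_val_one, cons_val_fin_one]
        rcases le_total (x 0) a with hx | hx
        · rw [min_eq_right (by linarith)] at h4
          rw [max_eq_right (by linarith)]; linarith
        · rw [min_eq_left (by linarith)] at h4
          rw [max_eq_left (by linarith)]; linarith
      · ext i
        fin_cases i <;> simp [sl2Apply_mk, stMap, htop] <;> ring
    · rintro ⟨z, ⟨z0, z1, z2⟩, rfl⟩
      refine ⟨![2 * a - 2 * z 0 - z 1, a - z 0 - z 1 - max (a - 2 * z 0 - z 1) 0],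
        ⟨⟨?_, ?_, ?_⟩, ?_⟩, ?_⟩
      all_goals try simp only [cons_val_zero, cons_val_one, cons_val_fin_one]
      · rcases le_total (a - 2 * z 0 - z 1) 0 with hx | hx
        · rw [max_eq_right (by linarith)]; linarith
        · rw [max_eq_left (by linarith)]; linarith
      · have := le_max_right (a - 2 * z 0 - z 1) 0
        linarith
      · have := le_max_left (a - 2 * z 0 - z 1) 0
        linarith
      · rcases le_total (a - 2 * z 0 - z 1) 0 with hx | hx
        · rw [max_eq_right (by linarith), min_eq_right (by linarith)]; linarith
        · rw [max_eq_left (by linarith), min_eq_left (by linarith)]; linarith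
      · have he : 2 * a - 2 * z 0 - z 1 - a = a - 2 * z 0 - z 1 := by ring
        ext i
        fin_cases i <;> simp [sl2Apply_mk, stMap, htop, he] <;> ring
  · simp [stMap, htop, h0]
  · ext y
    constructor
    · rintro ⟨⟨x, hx, rfl⟩, hy⟩
      exact ⟨⟨x, hx.1, rfl⟩, hy⟩
    · rintro ⟨⟨x, hx, rfl⟩, hy⟩
      refine ⟨⟨x, ⟨hx, ?_⟩, rfl⟩, hy⟩
      simp [stMap] at hy
      rcases le_total (x 0) a with h1 | h1
      · rw [max_eq_right (by linarith)] at hy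
        rw [min_eq_right (by linarith)]; linarith
      · rw [max_eq_left (by linarith)] at hy
        rw [min_eq_left (by linarith)]; linarith

theorem add_le_of_disjoint_leftTri_rightTri {a μ ν : ℝ} (hμ : μ ≤ a) (hν : ν ≤ a)
    (hd : Disjoint (leftTri a μ) (rightTri a ν)) : μ + ν ≤ a := by
  by_contra hcon
  rw [Set.disjoint_left] at hd
  rcases le_total ν μ with h | h
  · have h1 := min_le_right (2 * a - (a - μ + ν)) a
    have h2 := min_le_left (a - μ + ν) a
    refine hd (a := ![2 * a - (a - μ + ν), (a - μ + ν) / 2]) ⟨⟨?_, ?_, ?_⟩, ?_⟩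
      ⟨⟨?_, ?_, ?_⟩, ?_⟩ <;> simp <;> linarith
  · have h1 := min_le_right (2 * a - (a - ν + μ)) a
    have h2 := min_le_left (a - ν + μ) a
    refine hd (a := ![a - ν + μ, (a - ν + μ) / 2]) ⟨⟨?_, ?_, ?_⟩, ?_⟩
      ⟨⟨?_, ?_, ?_⟩, ?_⟩ <;> simp <;> linarith

theorem disjoint_leftTri_rightTri {a h : ℝ} (hh2 : h < a / 2) :
    Disjoint (leftTri a (a - h)) (rightTri a h) := by
  rw [Set.disjoint_left]
  rintro x ⟨⟨h1, h2, h3⟩, h4⟩ ⟨-, h5⟩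
  rcases le_total (x 0) a with hx | hx
  · rw [min_eq_right (by linarith)] at h5
    linarith
  · rw [min_eq_right hx] at h4
    rw [min_eq_left (by linarith)] at h5
    linarith

theorem leftTri_zero (a : ℝ) : leftTri a 0 = ∅ := by
  refine Set.eq_empty_of_forall_notMem ?_
  rintro x ⟨⟨h1, h2, h3⟩, h4⟩
  rcases min_cases (x 0) a with h | h <;> linarith

theorem rightTri_zero (a : ℝ) : rightTri a 0 = ∅ := by
  refine Set.eq_empty_of_forall_notMem ?_
  rintro x ⟨⟨h1, h2, h3⟩, h4⟩
  rcases min_cases (2 * a - x 0) a with h | h <;> linarith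

theorem left_mem_extremePoints (a : ℝ) (ha : 0 < a) :
    ![0, 0] ∈ Set.extremePoints ℝ (isoscelesTriangle a) := by
  refine ⟨⟨by simp, by simp, by simp [ha.le]⟩, ?_⟩
  rintro x ⟨h1, h2, h3⟩ y ⟨k1, k2, k3⟩ ⟨s, t, hs, ht, hst, he⟩
  have e0 : s * x 0 + t * y 0 = 0 := by simpa using congrFun he 0
  have hx0 : s * x 0 = 0 := by nlinarith
  have hx : x 0 = 0 := by simpa [hs.ne'] using hx0
  ext i
  fin_cases i
  · exact hx
  · simp; linarith

theorem right_mem_extremePoints (a : ℝ) (ha : 0 < a) :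
    ![2 * a, 0] ∈ Set.extremePoints ℝ (isoscelesTriangle a) := by
  refine ⟨⟨by simp, by simp [ha.le], by simp⟩, ?_⟩
  rintro x ⟨h1, h2, h3⟩ y ⟨k1, k2, k3⟩ ⟨s, t, hs, ht, hst, he⟩
  have e0 : s * x 0 + t * y 0 = 2 * a := by simpa using congrFun he 0
  have e1 : s * (2 * a - x 0) + t * (2 * a - y 0) = 0 := by
    linear_combination 2 * a * hst - e0
  have hx0 : s * (2 * a - x 0) = 0 := by nlinarith
  have hx : 2 * a - x 0 = 0 := by simpa [hs.ne'] using hx0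
  ext i
  fin_cases i
  · simp; linarith
  · simp; linarith

/-- Every packing is contained in the union of one left triangle and one right triangle whose
sizes satisfy the packing constraints. -/
theorem IsSTPackingIn.exists_subset {a h : ℝ} (ha : 0 < a) (hh1 : 0 < h) (hh2 : h < a / 2)
    {P : Set Pt} (hP : IsSTPackingIn (isoscelesTriangle a) (![![a, h]] : Fin 1 → Pt)
      (![1] : Fin 1 → ℤ) P) :
    ∃ μ ν : ℝ, 0 ≤ μ ∧ μ ≤ a - h ∧ 0 ≤ ν ∧ ν ≤ a - h ∧ μ + ν ≤ a ∧
      P ⊆ leftTri a μ ∪ rightTri a ν := by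
  obtain ⟨N, pt, lam, tri, rfl, hinj, hext, hpack, hdisj⟩ := hP
  have hL : ∃ μ : ℝ, 0 ≤ μ ∧ μ ≤ a - h ∧ (∀ i, pt i = ![0, 0] → tri i = leftTri a μ) ∧
      (μ = 0 ∨ ∃ i, pt i = ![0, 0]) := by
    by_cases hex : ∃ i, pt i = ![0, 0]
    · obtain ⟨i, hi⟩ := hex
      have h1 := hpack i
      rw [hi] at h1
      obtain ⟨h2, h3⟩ := h1.eq_leftTri ha hh1 hh2
      refine ⟨lam i, h1.1.le, h3, fun j hj => ?_, Or.inr ⟨i, hi⟩⟩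
      rw [hinj (hj.trans hi.symm), h2]
    · exact ⟨0, le_rfl, by linarith, fun i hi => (hex ⟨i, hi⟩).elim, Or.inl rfl⟩
  have hR : ∃ ν : ℝ, 0 ≤ ν ∧ ν ≤ a - h ∧ (∀ i, pt i = ![2 * a, 0] → tri i = rightTri a ν) ∧
      (ν = 0 ∨ ∃ i, pt i = ![2 * a, 0]) := by
    by_cases hex : ∃ i, pt i = ![2 * a, 0]
    · obtain ⟨i, hi⟩ := hex
      have h1 := hpack i
      rw [hi] at h1
      obtain ⟨h2, h3⟩ := h1.eq_rightTri ha hh1 hh2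
      refine ⟨lam i, h1.1.le, h3, fun j hj => ?_, Or.inr ⟨i, hi⟩⟩
      rw [hinj (hj.trans hi.symm), h2]
    · exact ⟨0, le_rfl, by linarith, fun i hi => (hex ⟨i, hi⟩).elim, Or.inl rfl⟩
  obtain ⟨μ, hμ0, hμ, hμt, hμe⟩ := hL
  obtain ⟨ν, hν0, hν, hνt, hνe⟩ := hR
  refine ⟨μ, ν, hμ0, hμ, hν0, hν, ?_, ?_⟩
  · refine add_le_of_disjoint_leftTri_rightTri (by linarith) (by linarith) ?_
    rcases hμe with rfl | ⟨i, hi⟩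
    · simp [leftTri_zero]
    rcases hνe with rfl | ⟨j, hj⟩
    · simp [rightTri_zero]
    rw [← hμt i hi, ← hνt j hj]
    refine hdisj fun hij => ?_
    rw [hij, hj] at hi
    have := congrFun hi 0
    simp [ha.ne'] at this
  · refine Set.iUnion_subset fun i => ?_
    have hi := hext i
    rw [← convexHull_eq_isoscelesTriangle ha] at hi
    rcases extremePoints_convexHull_subset hi with h1 | h1 | h1
    · rw [hμt i h1]
      exact subset_union_left
    · have h2 := hpack i
      rw [h1] at h2
      exact (not_isSTPackedTriangleIn_top ha h2).elim
    · rw [hνt i h1]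
      exact subset_union_right

theorem area_leftTri_union_rightTri_le {a μ ν : ℝ} (hμ0 : 0 ≤ μ) (hμ : μ ≤ a)
    (hν0 : 0 ≤ ν) (hν : ν ≤ a) {P : Set Pt} (hP : P ⊆ leftTri a μ ∪ rightTri a ν) :
    area P ≤ (μ ^ 2 + ν ^ 2) / 2 := by
  refine ENNReal.toReal_le_of_le_ofReal (by positivity) ?_
  calc volume P ≤ volume (leftTri a μ ∪ rightTri a ν) := measure_mono hP
    _ ≤ volume (leftTri a μ) + volume (rightTri a ν) := measure_union_le _ _
    _ = ENNReal.ofReal ((μ ^ 2 + ν ^ 2) / 2) := by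
      rw [volume_leftTri hμ0 hμ, volume_rightTri hν0 hν,
        ← ENNReal.ofReal_add (by positivity) (by positivity)]
      congr 1; ring

theorem area_leftTri_union_rightTri {a h : ℝ} (hh1 : 0 < h) (hh2 : h < a / 2) :
    area (leftTri a (a - h) ∪ rightTri a h) = ((a - h) ^ 2 + h ^ 2) / 2 := by
  rw [area, measure_union (disjoint_leftTri_rightTri hh2) (measurableSet_rightTri a h),
    volume_leftTri (by linarith) (by linarith), volume_rightTri (by linarith) (by linarith),
    ← ENNReal.ofReal_add (by positivity) (by positivity), ENNReal.toReal_ofReal (by positivity)]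
  ring

theorem isSTPackingIn_leftTri_union_rightTri {a h : ℝ} (ha : 0 < a) (hh1 : 0 < h)
    (hh2 : h < a / 2) :
    IsSTPackingIn (isoscelesTriangle a) (![![a, h]] : Fin 1 → Pt) (![1] : Fin 1 → ℤ)
      (leftTri a (a - h) ∪ rightTri a h) := by
  have hd := disjoint_leftTri_rightTri hh2
  refine ⟨2, ![![0, 0], ![2 * a, 0]], ![a - h, h], ![leftTri a (a - h), rightTri a h],
    ?_, ?_, ?_, ?_, ?_⟩
  · ext x
    simp [Fin.exists_fin_two]
  · intro i j hij
    have := congrFun hij 0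
    fin_cases i <;> fin_cases j <;> simp [ha.ne'] at this ⊢
  · rw [Fin.forall_fin_two]
    exact ⟨left_mem_extremePoints a ha, right_mem_extremePoints a ha⟩
  · rw [Fin.forall_fin_two]
    exact ⟨isSTPackedTriangleIn_leftTri (by simp; linarith) le_rfl hh1,
      isSTPackedTriangleIn_rightTri hh1 (by simp; linarith) hh1⟩
  · intro i j hij
    fin_cases i <;> fin_cases j
    · exact (hij rfl).elim
    · exact hd
    · exact hd.symm
    · exact (hij rfl).elim

theorem sq_add_sq_le_of_add_le {a h μ ν : ℝ} (hh2 : h < a / 2) (hμ0 : 0 ≤ μ) (hμ : μ ≤ a - h)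
    (hν0 : 0 ≤ ν) (hν : ν ≤ a - h) (hs : μ + ν ≤ a) :
    μ ^ 2 + ν ^ 2 ≤ (a - h) ^ 2 + h ^ 2 := by
  wlog hle : ν ≤ μ generalizing μ ν
  · linarith [this hν0 hν hμ0 hμ (by linarith) (by linarith)]
  rcases le_total ν h with hνh | hνh
  · exact add_le_add (pow_le_pow_left₀ hμ0 hμ 2) (pow_le_pow_left₀ hν0 hνh 2)
  · nlinarith [mul_nonneg (sub_nonneg.2 hνh) (sub_nonneg.2 hν), mul_self_nonneg (μ - ν)]

/-- The minimal semitoric polygon of type (1) — the triangle with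
vertices `(0,0)`, `(a, a/2)`, `(2a, 0)`, one marked point `(a,h)` with `0 < h < a/2`, and
upward cut — has semitoric packing density `ρ_ST = (a² + 2h² − 2ah)/a²`; in particular
`1/2 < ρ_ST < 1`. -/
theorem stmt14 (a h : ℝ) (ha : 0 < a) (hh1 : 0 < h) (hh2 : h < a / 2) :
    IsLUB
      (stDensitySet
        (convexHull ℝ {![0, 0], ![a, a / 2], ![2 * a, 0]})
        (![![a, h]] : Fin 1 → Pt) (![1] : Fin 1 → ℤ))
      ((a ^ 2 + 2 * h ^ 2 - 2 * a * h) / a ^ 2) ∧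
    1 / 2 < (a ^ 2 + 2 * h ^ 2 - 2 * a * h) / a ^ 2 ∧
    (a ^ 2 + 2 * h ^ 2 - 2 * a * h) / a ^ 2 < 1 := by
  have ha2 : 0 < a ^ 2 := by positivity
  have harea : area (isoscelesTriangle a) = a ^ 2 / 2 := by
    rw [area, volume_isoscelesTriangle ha, ENNReal.toReal_ofReal (by positivity)]
  rw [convexHull_eq_isoscelesTriangle ha]
  refine ⟨⟨?_, fun b hb => hb ?_⟩, ?_, ?_⟩
  · rintro r ⟨P, hP, rfl⟩
    obtain ⟨μ, ν, hμ0, hμ, hν0, hν, hs, hsub⟩ := hP.exists_subset ha hh1 hh2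
    have h1 := area_leftTri_union_rightTri_le hμ0 (by linarith) hν0 (by linarith) hsub
    have h2 := sq_add_sq_le_of_add_le hh2 hμ0 hμ hν0 hν hs
    rw [harea, div_le_div_iff₀ (by positivity) ha2]
    nlinarith
  · refine ⟨_, isSTPackingIn_leftTri_union_rightTri ha hh1 hh2, ?_⟩
    rw [harea, area_leftTri_union_rightTri hh1 hh2]
    field_simp
    ring
  · rw [div_lt_div_iff₀ two_pos ha2]
    nlinarith [mul_self_pos.2 (show a - 2 * h ≠ 0 by linarith)]
  · rw [div_lt_one ha2]
    nlinarith [mul_pos hh1 (show 0 < a - h by linarith)]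
end

section
/- Let a > 0, b ≥ 0, and 0 < h₁, h₂ < a, and let [Δ, ((a,h₁),(a+b,h₂)), (+1,+1)] be the minimal semitoric polygon of type (2): Δ has vertices (0,0), (a,a), (a+b,a), (2a+b,0), with marked points (a,h₁) and (a+b,h₂) and upward cuts. Then the semitoric packing density is ρ_ST = a/(a+b); in particular it is independent of h₁ and h₂, and equals 1 when b = 0. -/
open Matrix MeasureTheory Set

theorem sl2Apply_zero_coord (M : Matrix.SpecialLinearGroup (Fin 2) ℤ) (x : Pt) :
    sl2Apply M x 0 = (M 0 0 : ℝ) * x 0 + (M 0 1 : ℝ) * x 1 := by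
  simp [sl2Apply, Matrix.mulVec, dotProduct, Fin.sum_univ_two]

theorem sl2Apply_one_coord (M : Matrix.SpecialLinearGroup (Fin 2) ℤ) (x : Pt) :
    sl2Apply M x 1 = (M 1 0 : ℝ) * x 0 + (M 1 1 : ℝ) * x 1 := by
  simp [sl2Apply, Matrix.mulVec, dotProduct, Fin.sum_univ_two]

theorem pt_eq {x y : Pt} (h0 : x 0 = y 0) (h1 : x 1 = y 1) : x = y := by
  ext i; fin_cases i <;> assumption

theorem sl2_det_eq (M : Matrix.SpecialLinearGroup (Fin 2) ℤ) :
    M 0 0 * M 1 1 - M 0 1 * M 1 0 = 1 := by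
  have := M.det_coe
  rwa [Matrix.det_fin_two] at this

theorem continuous_sl2Apply (M : Matrix.SpecialLinearGroup (Fin 2) ℤ) :
    Continuous (sl2Apply M) := by
  unfold sl2Apply
  exact Continuous.matrix_mulVec continuous_const continuous_id

theorem exists_pos_forall_smul_add_mem {U : Set Pt} (hU : IsOpen U) {c : Pt} (hc : c ∈ U)
    (w : Pt) : ∃ r > 0, ∀ s : ℝ, 0 < s → s < r → s • w + c ∈ U := by
  have hcont : Continuous fun s : ℝ => s • w + c := by fun_prop
  have hmem : (fun s : ℝ => s • w + c) ⁻¹' U ∈ nhds (0 : ℝ) :=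
    (hU.preimage hcont).mem_nhds (by simpa using hc)
  obtain ⟨r, hr, hsub⟩ := Metric.mem_nhds_iff.1 hmem
  refine ⟨r, hr, fun s h0 h1 => hsub ?_⟩
  simp [abs_of_pos h0, h1]

/-- A Delzant triangle that agrees near its vertex `c` with a set `S` contains the initial
part of every edge of `S` at `c` with primitive integer direction. -/
theorem smul_add_mem_of_edge (M : Matrix.SpecialLinearGroup (Fin 2) ℤ) {lam : ℝ} (hlam : 0 < lam)
    {c : Pt} {S U : Set Pt} (hU : IsOpen U) (hc : c ∈ U)
    (heq : ((fun x => sl2Apply M x + c) '' modelTriangle lam) ∩ U = S ∩ U)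
    (w : Fin 2 → ℤ) (hw : IsCoprime (w 0) (w 1)) {r : ℝ} (hr : 0 < r)
    (hin : ∀ s : ℝ, 0 < s → s < r → s • (fun i => (w i : ℝ)) + c ∈ S)
    (hside : (∀ q ∈ S, 0 ≤ (w 0 : ℝ) * (q 1 - c 1) - w 1 * (q 0 - c 0)) ∨
      (∀ q ∈ S, (w 0 : ℝ) * (q 1 - c 1) - w 1 * (q 0 - c 0) ≤ 0))
    {s : ℝ} (hs0 : 0 ≤ s) (hs : s < lam) :
    s • (fun i => (w i : ℝ)) + c ∈ (fun x => sl2Apply M x + c) '' modelTriangle lam := by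
  have hdet := sl2_det_eq M
  have hdetR : (M 0 0 : ℝ) * M 1 1 - M 0 1 * M 1 0 = 1 := by exact_mod_cast hdet
  have hcol : ∀ j : Fin 2, ∃ e : ℝ, 0 < e ∧ e • (fun i => (M i j : ℝ)) + c ∈ S := by
    intro j
    obtain ⟨r', hr', hU'⟩ := exists_pos_forall_smul_add_mem hU hc (fun i => (M i j : ℝ))
    have hmin : 0 < min r' lam := lt_min hr' hlam
    have h1 : min r' lam / 2 < r' := by have := min_le_left r' lam; linarith
    have h2 : min r' lam / 2 < lam := by have := min_le_right r' lam; linarith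
    refine ⟨min r' lam / 2, by linarith, ?_⟩
    set e := min r' lam / 2 with he
    have he0 : 0 < e := by linarith
    have : e • (fun i => (M i j : ℝ)) + c ∈
        ((fun x => sl2Apply M x + c) '' modelTriangle lam) ∩ U := by
      refine ⟨⟨Pi.single j e, ?_, ?_⟩, hU' _ he0 h1⟩
      · fin_cases j <;> simp [modelTriangle, he0.le, h2]
      · apply pt_eq
        · fin_cases j <;> simp [sl2Apply_zero_coord, mul_comm]
        · fin_cases j <;> simp [sl2Apply_one_coord, mul_comm]
    rw [heq] at this
    exact this.1
  obtain ⟨e0, he0, hS0⟩ := hcol 0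
  obtain ⟨e1, he1, hS1⟩ := hcol 1
  obtain ⟨r', hr', hU'⟩ := exists_pos_forall_smul_add_mem hU hc (fun i => (w i : ℝ))
  have hmin : 0 < min r' r := lt_min hr' hr
  have h1 : min r' r / 2 < r' := by have := min_le_left r' r; linarith
  have h2 : min r' r / 2 < r := by have := min_le_right r' r; linarith
  obtain ⟨v, hv, hveq⟩ := (heq.symm.le ⟨hin (min r' r / 2) (by linarith) h2,
    hU' (min r' r / 2) (by linarith) h1⟩).1
  set e := min r' r / 2
  have hepos : 0 < e := by simp only [e]; linarith
  have hv0 := congrFun hveq 0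
  have hv1 := congrFun hveq 1
  simp only [Pi.add_apply, sl2Apply_zero_coord, sl2Apply_one_coord, Pi.smul_apply, smul_eq_mul,
    add_left_inj] at hv0 hv1
  obtain ⟨hα, hβ, -⟩ := hv
  have hk : 0 ≤ w 0 * M 1 1 - w 1 * M 0 1 := by
    have : v 0 = e * ((w 0 : ℝ) * M 1 1 - w 1 * M 0 1) := by
      linear_combination (-v 0) * hdetR + (M 1 1 : ℝ) * hv0 - (M 0 1 : ℝ) * hv1
    rw [this] at hα
    exact_mod_cast nonneg_of_mul_nonneg_right hα hepos
  have hl : 0 ≤ w 1 * M 0 0 - w 0 * M 1 0 := by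
    have : v 1 = e * ((w 1 : ℝ) * M 0 0 - w 0 * M 1 0) := by
      linear_combination (-v 1) * hdetR + (M 0 0 : ℝ) * hv1 - (M 1 0 : ℝ) * hv0
    rw [this] at hβ
    exact_mod_cast nonneg_of_mul_nonneg_right hβ hepos
  have hw0 : w 0 = (w 0 * M 1 1 - w 1 * M 0 1) * M 0 0 + (w 1 * M 0 0 - w 0 * M 1 0) * M 0 1 := by
    linear_combination (-w 0) * hdet
  have hw1 : w 1 = (w 0 * M 1 1 - w 1 * M 0 1) * M 1 0 + (w 1 * M 0 0 - w 0 * M 1 0) * M 1 1 := by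
    linear_combination (-w 1) * hdet
  set k := w 0 * M 1 1 - w 1 * M 0 1 with hkdef
  set l := w 1 * M 0 0 - w 0 * M 1 0 with hldef
  have unit_of : ∀ d x y : ℤ, 0 ≤ d → w 0 = d * x → w 1 = d * y → d = 1 := by
    intro d x y hd hx hy
    have : IsUnit d := hw.isUnit_of_dvd' ⟨x, hx⟩ ⟨y, hy⟩
    rcases Int.isUnit_iff.1 this with h | h <;> omega
  rcases hside with hside | hside
  · have hl0 : l = 0 := by
      have := hside _ hS0
      simp only [Pi.add_apply, Pi.smul_apply, smul_eq_mul, add_sub_cancel_right] at this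
      have h3 : 0 ≤ e0 * ((w 0 : ℝ) * M 1 0 - w 1 * M 0 0) := by linarith
      have h4 : 0 ≤ w 0 * M 1 0 - w 1 * M 0 0 := by
        exact_mod_cast nonneg_of_mul_nonneg_right h3 he0
      omega
    rw [hl0, zero_mul, add_zero] at hw0 hw1
    have hk1 := unit_of _ _ _ hk hw0 hw1
    rw [hk1, one_mul] at hw0 hw1
    refine ⟨![s, 0], by simp [modelTriangle, hs0, hs], ?_⟩
    apply pt_eq
    · simp [sl2Apply_zero_coord, hw0, mul_comm]
    · simp [sl2Apply_one_coord, hw1, mul_comm]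
  · have hk0 : k = 0 := by
      have := hside _ hS1
      simp only [Pi.add_apply, Pi.smul_apply, smul_eq_mul, add_sub_cancel_right] at this
      have h3 : 0 ≤ e1 * ((w 1 : ℝ) * M 0 1 - w 0 * M 1 1) := by linarith
      have h4 : 0 ≤ w 1 * M 0 1 - w 0 * M 1 1 := by
        exact_mod_cast nonneg_of_mul_nonneg_right h3 he1
      omega
    rw [hk0, zero_mul, zero_add] at hw0 hw1
    have hl1 := unit_of _ _ _ hl hw0 hw1
    rw [hl1, one_mul] at hw0 hw1
    refine ⟨![0, s], by simp [modelTriangle, hs0, hs], ?_⟩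
    apply pt_eq
    · simp [sl2Apply_zero_coord, hw0, mul_comm]
    · simp [sl2Apply_one_coord, hw1, mul_comm]

theorem modelTriangle_measurableSet (lam : ℝ) : MeasurableSet (modelTriangle lam) := by
  unfold modelTriangle
  measurability

theorem volume_modelTriangle {lam : ℝ} (hlam : 0 ≤ lam) :
    volume (modelTriangle lam) = ENNReal.ofReal (lam ^ 2 / 2) := by
  have hmp := (MeasureTheory.volume_preserving_finTwoArrow ℝ).symm
  rw [← hmp.measure_preimage (modelTriangle_measurableSet lam).nullMeasurableSet,
    Measure.volume_eq_prod,
    Measure.prod_apply (hmp.measurable (modelTriangle_measurableSet lam))]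
  have hslice : ∀ x : ℝ, volume (Prod.mk x ⁻¹' ((MeasurableEquiv.finTwoArrow (α := ℝ)).symm ⁻¹'
      modelTriangle lam)) = (Icc 0 lam).indicator (fun x => ENNReal.ofReal (lam - x)) x := by
    intro x
    by_cases hx : 0 ≤ x
    · have : (Prod.mk x ⁻¹' ((MeasurableEquiv.finTwoArrow (α := ℝ)).symm ⁻¹'
          modelTriangle lam)) = Ico 0 (lam - x) := by
        ext y
        simp [modelTriangle, hx, lt_sub_iff_add_lt']
      rw [this, Real.volume_Ico, sub_zero]
      by_cases hx' : x ≤ lam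
      · rw [indicator_of_mem (show x ∈ Icc 0 lam from ⟨hx, hx'⟩)]
      · rw [indicator_of_notMem (fun h => hx' h.2), ENNReal.ofReal_of_nonpos (by linarith)]
    · have : (Prod.mk x ⁻¹' ((MeasurableEquiv.finTwoArrow (α := ℝ)).symm ⁻¹'
          modelTriangle lam)) = ∅ := by
        ext y
        simp [modelTriangle, hx]
      rw [this, measure_empty, indicator_of_notMem (fun h => hx h.1)]
  simp_rw [hslice]
  rw [lintegral_indicator measurableSet_Icc, ← ofReal_integral_eq_lintegral_ofReal]
  · rw [integral_Icc_eq_integral_Ioc, ← intervalIntegral.integral_of_le hlam]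
    rw [intervalIntegral.integral_sub (by simp) (by simp), intervalIntegral.integral_const,
      integral_id, smul_eq_mul]
    congr 1
    ring
  · exact (Continuous.integrableOn_Icc (by fun_prop))
  · filter_upwards [ae_restrict_mem measurableSet_Icc] with x hx
    simpa using hx.2

theorem measurePreserving_sl2Apply (M : Matrix.SpecialLinearGroup (Fin 2) ℤ) :
    MeasurePreserving (sl2Apply M) volume volume := by
  refine ⟨(continuous_sl2Apply M).measurable, ?_⟩
  have hdet : ((M : Matrix (Fin 2) (Fin 2) ℤ).map (Int.cast : ℤ → ℝ)).det = 1 := by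
    rw [Matrix.det_fin_two]
    simp only [Matrix.map_apply]
    exact_mod_cast sl2_det_eq M
  have := Real.map_matrix_volume_pi_eq_smul_volume_pi
    (M := (M : Matrix (Fin 2) (Fin 2) ℤ).map (Int.cast : ℤ → ℝ)) (by rw [hdet]; exact one_ne_zero)
  rw [hdet] at this
  simp only [inv_one, abs_one, ENNReal.ofReal_one, one_smul] at this
  exact this

theorem measurePreserving_stMap {m : ℕ} (c : Fin m → Pt) (n : ℤ) (t : ℝ) (u : Fin m → ℤ) :
    MeasurePreserving (stMap c n t u) volume volume := by
  set g : ℝ → ℝ → ℝ := fun x y => y + ((n : ℝ) * x + t + ∑ j, (u j : ℝ) * max (x - c j 0) 0)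
    with hg
  have hsk : MeasurePreserving (fun p : ℝ × ℝ => (id p.1, g p.1 p.2)) (volume.prod volume)
      (volume.prod volume) := by
    refine (MeasurePreserving.id volume).skew_product ?_ (ae_of_all _ fun x => ?_)
    · simp only [hg, Function.uncurry_def]
      fun_prop
    · exact (measurePreserving_add_right volume _).map_eq
  have h := (volume_preserving_finTwoArrow ℝ).symm.comp
    (hsk.comp (volume_preserving_finTwoArrow ℝ))
  convert h using 1
  funext x
  apply pt_eq
  · simp [stMap]
  · simp [stMap, hg]
    ring

theorem sl2Apply_inv_apply (M : Matrix.SpecialLinearGroup (Fin 2) ℤ) (x : Pt) :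
    sl2Apply M⁻¹ (sl2Apply M x) = x := by
  have hdet : (M 0 0 : ℝ) * M 1 1 - M 0 1 * M 1 0 = 1 := by exact_mod_cast sl2_det_eq M
  apply pt_eq
  · rw [sl2Apply_zero_coord, sl2Apply_zero_coord, sl2Apply_one_coord]
    simp only [Matrix.SpecialLinearGroup.coe_inv, Matrix.adjugate_fin_two, Matrix.of_apply,
      Matrix.cons_val', Matrix.cons_val_zero, Matrix.cons_val_one, Matrix.cons_val_fin_one]
    push_cast
    linear_combination x 0 * hdet
  · rw [sl2Apply_one_coord, sl2Apply_zero_coord, sl2Apply_one_coord]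
    simp only [Matrix.SpecialLinearGroup.coe_inv, Matrix.adjugate_fin_two, Matrix.of_apply,
      Matrix.cons_val', Matrix.cons_val_zero, Matrix.cons_val_one, Matrix.cons_val_fin_one]
    push_cast
    linear_combination x 1 * hdet

theorem volume_eq_of_stMap_image {m : ℕ} {c : Fin m → Pt} {n : ℤ} {t : ℝ} {u : Fin m → ℤ}
    {M : Matrix.SpecialLinearGroup (Fin 2) ℤ} {p : Pt} {lam : ℝ} {B : Set Pt} (hlam : 0 ≤ lam)
    (h : stMap c n t u '' B = (fun x => sl2Apply M x + p) '' modelTriangle lam) :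
    volume B = ENNReal.ofReal (lam ^ 2 / 2) := by
  have hmp : MeasurePreserving (fun x => sl2Apply M⁻¹ (stMap c n t u x - p)) volume volume :=
    (measurePreserving_sl2Apply M⁻¹).comp
      ((measurePreserving_sub_right volume p).comp (measurePreserving_stMap c n t u))
  have hB : B = (fun x => sl2Apply M⁻¹ (stMap c n t u x - p)) ⁻¹' modelTriangle lam := by
    ext x
    rw [← (stMap_injective c n t u).mem_set_image, h]
    constructor
    · rintro ⟨y, hy, hyx⟩
      simp only [mem_preimage, ← hyx, add_sub_cancel_right, sl2Apply_inv_apply]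
      exact hy
    · intro hx
      refine ⟨_, hx, ?_⟩
      have := sl2Apply_inv_apply M⁻¹ (stMap c n t u x - p)
      rw [inv_inv] at this
      simp [this]
  rw [hB, hmp.measure_preimage (modelTriangle_measurableSet lam).nullMeasurableSet,
    volume_modelTriangle hlam]

theorem IsSTPackedTriangleIn.volume_eq {m : ℕ} {Δ : Set Pt} {c : Fin m → Pt} {eps : Fin m → ℤ}
    {p : Pt} {lam : ℝ} {B : Set Pt} (h : IsSTPackedTriangleIn Δ c eps p lam B) :
    volume B = ENNReal.ofReal (lam ^ 2 / 2) := by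
  obtain ⟨hlam, -, -, n, t, u, -, ⟨M, hM⟩, -⟩ := h
  exact volume_eq_of_stMap_image hlam.le hM

theorem IsSTPackedTriangleIn.exists_edge_mem {m : ℕ} {Δ : Set Pt} {c : Fin m → Pt}
    {eps : Fin m → ℤ} {p : Pt} {lam : ℝ} {B : Set Pt} (h : IsSTPackedTriangleIn Δ c eps p lam B) :
    ∃ (n : ℤ) (t : ℝ) (u : Fin m → ℤ), (∀ j, u j = 0 ∨ u j = eps j) ∧
      ∀ w0 w1 : ℤ, IsCoprime w0 w1 →
        (∃ r > 0, ∀ s : ℝ, 0 < s → s < r →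
          ∃ q ∈ Δ, stMap c n t u q = s • ![(w0 : ℝ), w1] + stMap c n t u p) →
        ((∀ q ∈ Δ, 0 ≤ (w0 : ℝ) * (stMap c n t u q 1 - stMap c n t u p 1) - w1 * (q 0 - p 0)) ∨
          (∀ q ∈ Δ, (w0 : ℝ) * (stMap c n t u q 1 - stMap c n t u p 1) - w1 * (q 0 - p 0) ≤ 0)) →
        ∀ s : ℝ, 0 ≤ s → s < lam →
          ∃ q ∈ B, stMap c n t u q = s • ![(w0 : ℝ), w1] + stMap c n t u p := by
  obtain ⟨hlam, -, -, n, t, u, hu, ⟨M, hM⟩, U, hU, hpU, heq⟩ := h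
  refine ⟨n, t, u, hu, ?_⟩
  rintro w0 w1 hw ⟨r, hr, hin⟩ hside s hs0 hs
  rw [hM] at heq
  have hcast : (fun i => ((![w0, w1] : Fin 2 → ℤ) i : ℝ)) = ![(w0 : ℝ), w1] := by
    apply pt_eq <;> simp
  have := smul_add_mem_of_edge M hlam hU hpU heq ![w0, w1] (by simpa using hw) hr
    (by rw [hcast]; exact hin) ?_ hs0 hs
  · rw [hcast, ← hM] at this
    exact this
  · simpa [stMap] using hside

/-- The trapezoid with vertices `(0,0)`, `(a,a)`, `(a+b,a)`, `(2a+b,0)`, by inequalities. -/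
def trapezoid (a b : ℝ) : Set Pt :=
  {x | 0 ≤ x 1 ∧ x 1 ≤ x 0 ∧ x 1 ≤ a ∧ x 0 + x 1 ≤ 2 * a + b}

theorem convex_trapezoid (a b : ℝ) : Convex ℝ (trapezoid a b) := by
  rintro x ⟨hx1, hx2, hx3, hx4⟩ y ⟨hy1, hy2, hy3, hy4⟩ s t hs ht hst
  obtain rfl : t = 1 - s := by linarith
  simp only [trapezoid, mem_ofPred_eq, Pi.add_apply, Pi.smul_apply, smul_eq_mul]
  refine ⟨?_, ?_, ?_, ?_⟩
  · positivity
  · nlinarith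
  · nlinarith
  · nlinarith

theorem convexHull_eq_trapezoid {a b : ℝ} (ha : 0 < a) (hb : 0 ≤ b) :
    convexHull ℝ {![0, 0], ![a, a], ![a + b, a], ![2 * a + b, 0]} = trapezoid a b := by
  apply Subset.antisymm
  · refine convexHull_min ?_ (convex_trapezoid a b)
    rintro x (rfl | rfl | rfl | rfl) <;> refine ⟨?_, ?_, ?_, ?_⟩ <;> simp <;> linarith
  · rintro x ⟨h1, h2, h3, h4⟩
    set K := convexHull ℝ ({![0, 0], ![a, a], ![a + b, a], ![2 * a + b, 0]} : Set Pt) with hK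
    have hconv : Convex ℝ K := convex_convexHull ℝ _
    have hmem : ∀ v ∈ ({![0, 0], ![a, a], ![a + b, a], ![2 * a + b, 0]} : Set Pt), v ∈ K :=
      fun v hv => subset_convexHull ℝ _ hv
    have ht0 : 0 ≤ x 1 / a := by positivity
    have ht1 : 0 ≤ 1 - x 1 / a := by
      rw [sub_nonneg, div_le_one ha]; exact h3
    have hl : ![x 1, x 1] ∈ K := by
      have := hconv (hmem ![0, 0] (by simp)) (hmem ![a, a] (by simp)) ht1 ht0 (by ring)
      convert this using 1
      apply pt_eq <;> simp <;> field_simp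
    have hr : ![2 * a + b - x 1, x 1] ∈ K := by
      have := hconv (hmem ![2 * a + b, 0] (by simp)) (hmem ![a + b, a] (by simp)) ht1 ht0 (by ring)
      convert this using 1
      apply pt_eq <;> simp <;> field_simp
      ring
    rcases eq_or_lt_of_le h2 with h | h
    · convert hl using 1
      apply pt_eq <;> simp [h]
    · have hpos : 0 < 2 * a + b - 2 * x 1 := by linarith
      have hs0 : 0 ≤ (x 0 - x 1) / (2 * a + b - 2 * x 1) := div_nonneg (by linarith) hpos.le
      have hs1 : 0 ≤ 1 - (x 0 - x 1) / (2 * a + b - 2 * x 1) := by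
        rw [sub_nonneg, div_le_one hpos]; linarith
      have := hconv hl hr hs1 hs0 (by ring)
      convert this using 1
      apply pt_eq
      · have hcancel : (x 0 - x 1) / (2 * a + b - 2 * x 1) * (2 * a + b - 2 * x 1) = x 0 - x 1 :=
          div_mul_cancel₀ _ hpos.ne'
        simp only [Pi.add_apply, Pi.smul_apply, smul_eq_mul, Matrix.cons_val_zero]
        linear_combination -hcancel
      · simp
        ring

theorem stMap_pair_one_coord (a b h₁ h₂ : ℝ) (n : ℤ) (t : ℝ) (u : Fin 2 → ℤ) (x : Pt) :
    stMap (![![a, h₁], ![a + b, h₂]] : Fin 2 → Pt) n t u x 1 =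
      x 1 + n * x 0 + t + (u 0 * max (x 0 - a) 0 + u 1 * max (x 0 - (a + b)) 0) := by
  simp [stMap, Fin.sum_univ_two]

theorem stMap_zero_coord {m : ℕ} (c : Fin m → Pt) (n : ℤ) (t : ℝ) (u : Fin m → ℤ) (x : Pt) :
    stMap c n t u x 0 = x 0 := by
  simp [stMap]

section PackedTriangles

variable {a b h₁ h₂ lam : ℝ} {B : Set Pt}

theorem packed_bottom_left (ha : 0 < a) (hb : 0 ≤ b)
    (h : IsSTPackedTriangleIn (trapezoid a b) ![![a, h₁], ![a + b, h₂]] ![1, 1] ![0, 0] lam B) :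
    lam ≤ a ∧ ∀ s, 0 ≤ s → s < lam → ![s, s] ∈ B := by
  have hBsub := h.2.1
  obtain ⟨n, t, u, hu, H⟩ := h.exists_edge_mem
  have hu0 : (u 0 : ℝ) = 0 ∨ (u 0 : ℝ) = 1 := by simpa using hu 0
  have hu1 : (u 1 : ℝ) = 0 ∨ (u 1 : ℝ) = 1 := by simpa using hu 1
  have hma : max (0 - a) 0 = 0 := max_eq_right (by linarith)
  have hmb : max (0 - (a + b)) 0 = 0 := max_eq_right (by linarith)
  have top := H 1 (1 + n) isCoprime_one_left
    ⟨a, ha, fun s hs0 hs => ⟨![s, s], by refine ⟨?_, ?_, ?_, ?_⟩ <;> simp <;> linarith, by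
      apply pt_eq
      · simp [stMap_zero_coord]
      · simp only [stMap_pair_one_coord, Pi.add_apply, Pi.smul_apply, smul_eq_mul,
          Matrix.cons_val_zero, Matrix.cons_val_one, hma, hmb,
          max_eq_right (show s - a ≤ 0 by linarith),
          max_eq_right (show s - (a + b) ≤ 0 by linarith)]
        push_cast
        ring⟩⟩
    (Or.inr fun q hq => by
      obtain ⟨q1, q2, q3, q4⟩ := hq
      simp only [stMap_pair_one_coord, Matrix.cons_val_zero, Matrix.cons_val_one, hma, hmb]
      push_cast
      rcases max_cases (q 0 - a) 0 with ⟨e, e'⟩ | ⟨e, e'⟩ <;>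
      rcases max_cases (q 0 - (a + b)) 0 with ⟨f, f'⟩ | ⟨f, f'⟩ <;>
      rcases hu0 with g | g <;> rcases hu1 with k | k <;> rw [e, f, g, k] <;> linarith)
  have bot := H 1 n isCoprime_one_left
    ⟨a, ha, fun s hs0 hs => ⟨![s, 0], by refine ⟨?_, ?_, ?_, ?_⟩ <;> simp <;> linarith, by
      apply pt_eq
      · simp [stMap_zero_coord]
      · simp only [stMap_pair_one_coord, Pi.add_apply, Pi.smul_apply, smul_eq_mul,
          Matrix.cons_val_zero, Matrix.cons_val_one, hma, hmb,
          max_eq_right (show s - a ≤ 0 by linarith),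
          max_eq_right (show s - (a + b) ≤ 0 by linarith)]
        ring⟩⟩
    (Or.inl fun q hq => by
      obtain ⟨q1, q2, q3, q4⟩ := hq
      simp only [stMap_pair_one_coord, Matrix.cons_val_zero, Matrix.cons_val_one, hma, hmb]
      push_cast
      rcases max_cases (q 0 - a) 0 with ⟨e, e'⟩ | ⟨e, e'⟩ <;>
      rcases max_cases (q 0 - (a + b)) 0 with ⟨f, f'⟩ | ⟨f, f'⟩ <;>
      rcases hu0 with g | g <;> rcases hu1 with k | k <;> rw [e, f, g, k] <;> linarith)
  have key : ∀ s, 0 ≤ s → s < lam → s ≤ a := by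
    intro s hs0 hs
    obtain ⟨q, hq, hqe⟩ := top s hs0 hs
    obtain ⟨q', hq', hqe'⟩ := bot s hs0 hs
    have e0 := congrFun hqe 0
    have e1 := congrFun hqe 1
    have f0 := congrFun hqe' 0
    have f1 := congrFun hqe' 1
    simp only [Pi.add_apply, Pi.smul_apply, smul_eq_mul, stMap_zero_coord, stMap_pair_one_coord,
      Matrix.cons_val_zero, Matrix.cons_val_one] at e0 e1 f0 f1
    push_cast at e0 e1 f0 f1
    rw [f0] at f1
    rw [e0] at e1
    have := (hBsub hq).2.2.1
    have := (hBsub hq').1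
    linarith
  refine ⟨le_of_forall_lt_imp_le_of_dense fun s hs => ?_, fun s hs0 hs => ?_⟩
  · rcases le_or_gt 0 s with h0 | h0
    · exact key s h0 hs
    · linarith
  · obtain ⟨q, hq, hqe⟩ := top s hs0 hs
    have hsa := key s hs0 hs
    convert hq using 1
    apply stMap_injective _ n t u
    rw [hqe]
    apply pt_eq
    · simp [stMap_zero_coord]
    · simp only [stMap_pair_one_coord, Pi.add_apply, Pi.smul_apply, smul_eq_mul,
        Matrix.cons_val_zero, Matrix.cons_val_one, hma, hmb,
        max_eq_right (show s - a ≤ 0 by linarith),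
        max_eq_right (show s - (a + b) ≤ 0 by linarith)]
      push_cast
      ring

theorem packed_top_left (ha : 0 < a) (hb : 0 ≤ b)
    (h : IsSTPackedTriangleIn (trapezoid a b) ![![a, h₁], ![a + b, h₂]] ![1, 1] ![a, a] lam B) :
    lam ≤ a ∧ ∀ s, 0 ≤ s → s < lam → ![a - s, a - s] ∈ B := by
  have hBsub := h.2.1
  obtain ⟨n, t, u, hu, H⟩ := h.exists_edge_mem
  have hu0 : (u 0 : ℝ) = 0 ∨ (u 0 : ℝ) = 1 := by simpa using hu 0
  have hu1 : (u 1 : ℝ) = 0 ∨ (u 1 : ℝ) = 1 := by simpa using hu 1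
  have hmb : max (a - (a + b)) 0 = 0 := max_eq_right (by linarith)
  have heq : ∀ s, 0 ≤ s → stMap (![![a, h₁], ![a + b, h₂]] : Fin 2 → Pt) n t u ![a - s, a - s] =
      s • ![((-1 : ℤ) : ℝ), ((-1 - n : ℤ) : ℝ)] +
        stMap (![![a, h₁], ![a + b, h₂]] : Fin 2 → Pt) n t u ![a, a] := by
    intro s hs
    apply pt_eq
    · simp [stMap_zero_coord]
      ring
    · simp only [stMap_pair_one_coord, Pi.add_apply, Pi.smul_apply, smul_eq_mul,
        Matrix.cons_val_zero, Matrix.cons_val_one, hmb, sub_self, max_self,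
        max_eq_right (show a - s - a ≤ 0 by linarith),
        max_eq_right (show a - s - (a + b) ≤ 0 by linarith)]
      push_cast
      ring
  have edge := H (-1) (-1 - n) isCoprime_one_left.neg_left
    ⟨a, ha, fun s hs0 hs => ⟨![a - s, a - s],
      by refine ⟨?_, ?_, ?_, ?_⟩ <;> simp <;> linarith, heq s hs0.le⟩⟩
    (Or.inl fun q hq => by
      obtain ⟨q1, q2, q3, q4⟩ := hq
      simp only [stMap_pair_one_coord, Matrix.cons_val_zero, Matrix.cons_val_one, hmb, sub_self,
        max_self]
      push_cast
      rcases max_cases (q 0 - a) 0 with ⟨e, e'⟩ | ⟨e, e'⟩ <;>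
      rcases max_cases (q 0 - (a + b)) 0 with ⟨f, f'⟩ | ⟨f, f'⟩ <;>
      rcases hu0 with g | g <;> rcases hu1 with k | k <;> rw [e, f, g, k] <;> linarith)
  have hmem : ∀ s, 0 ≤ s → s < lam → ![a - s, a - s] ∈ B := by
    intro s hs0 hs
    obtain ⟨q, hq, hqe⟩ := edge s hs0 hs
    convert hq using 1
    apply stMap_injective _ n t u
    rw [hqe, heq s hs0]
  refine ⟨le_of_forall_lt_imp_le_of_dense fun s hs => ?_, hmem⟩
  rcases le_or_gt 0 s with h0 | h0
  · have := (hBsub (hmem s h0 hs)).1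
    simpa using this
  · linarith

theorem packed_top_right (ha : 0 < a) (hb : 0 ≤ b)
    (h : IsSTPackedTriangleIn (trapezoid a b) ![![a, h₁], ![a + b, h₂]] ![1, 1]
      ![a + b, a] lam B) :
    lam ≤ a ∧ ∀ s, 0 ≤ s → s < lam → ![a + b + s, a - s] ∈ B := by
  have hBsub := h.2.1
  obtain ⟨n, t, u, hu, H⟩ := h.exists_edge_mem
  have hu0 : (u 0 : ℝ) = 0 ∨ (u 0 : ℝ) = 1 := by simpa using hu 0
  have hu1 : (u 1 : ℝ) = 0 ∨ (u 1 : ℝ) = 1 := by simpa using hu 1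
  have hma : max (a + b - a) 0 = a + b - a := max_eq_left (by linarith)
  have heq : ∀ s, 0 ≤ s →
      stMap (![![a, h₁], ![a + b, h₂]] : Fin 2 → Pt) n t u ![a + b + s, a - s] =
      s • ![((1 : ℤ) : ℝ), ((-1 + n + u 0 + u 1 : ℤ) : ℝ)] +
        stMap (![![a, h₁], ![a + b, h₂]] : Fin 2 → Pt) n t u ![a + b, a] := by
    intro s hs
    apply pt_eq
    · simp [stMap_zero_coord]
      ring
    · simp only [stMap_pair_one_coord, Pi.add_apply, Pi.smul_apply, smul_eq_mul,
        Matrix.cons_val_zero, Matrix.cons_val_one, hma, sub_self, max_self,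
        max_eq_left (show 0 ≤ a + b + s - a by linarith),
        max_eq_left (show 0 ≤ a + b + s - (a + b) by linarith)]
      push_cast
      ring
  have edge := H 1 (-1 + n + u 0 + u 1) isCoprime_one_left
    ⟨a, ha, fun s hs0 hs => ⟨![a + b + s, a - s],
      by refine ⟨?_, ?_, ?_, ?_⟩ <;> simp <;> linarith, heq s hs0.le⟩⟩
    (Or.inr fun q hq => by
      obtain ⟨q1, q2, q3, q4⟩ := hq
      simp only [stMap_pair_one_coord, Matrix.cons_val_zero, Matrix.cons_val_one, hma, sub_self,
        max_self]
      push_cast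
      rcases max_cases (q 0 - a) 0 with ⟨e, e'⟩ | ⟨e, e'⟩ <;>
      rcases max_cases (q 0 - (a + b)) 0 with ⟨f, f'⟩ | ⟨f, f'⟩ <;>
      rcases hu0 with g | g <;> rcases hu1 with k | k <;> rw [e, f, g, k] <;> linarith)
  have hmem : ∀ s, 0 ≤ s → s < lam → ![a + b + s, a - s] ∈ B := by
    intro s hs0 hs
    obtain ⟨q, hq, hqe⟩ := edge s hs0 hs
    convert hq using 1
    apply stMap_injective _ n t u
    rw [hqe, heq s hs0]
  refine ⟨le_of_forall_lt_imp_le_of_dense fun s hs => ?_, hmem⟩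
  rcases le_or_gt 0 s with h0 | h0
  · have := (hBsub (hmem s h0 hs)).1
    simpa using this
  · linarith

theorem packed_bottom_right (ha : 0 < a) (hb : 0 ≤ b)
    (h : IsSTPackedTriangleIn (trapezoid a b) ![![a, h₁], ![a + b, h₂]] ![1, 1]
      ![2 * a + b, 0] lam B) :
    lam ≤ a ∧ ∀ s, 0 ≤ s → s < lam → ![2 * a + b - s, s] ∈ B := by
  have hBsub := h.2.1
  obtain ⟨n, t, u, hu, H⟩ := h.exists_edge_mem
  have hu0 : (u 0 : ℝ) = 0 ∨ (u 0 : ℝ) = 1 := by simpa using hu 0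
  have hu1 : (u 1 : ℝ) = 0 ∨ (u 1 : ℝ) = 1 := by simpa using hu 1
  have hma : max (2 * a + b - a) 0 = 2 * a + b - a := max_eq_left (by linarith)
  have hmb : max (2 * a + b - (a + b)) 0 = 2 * a + b - (a + b) := max_eq_left (by linarith)
  have heq : ∀ s, s ≤ a →
      stMap (![![a, h₁], ![a + b, h₂]] : Fin 2 → Pt) n t u ![2 * a + b - s, s] =
      s • ![((-1 : ℤ) : ℝ), ((1 - (n + u 0 + u 1) : ℤ) : ℝ)] +
        stMap (![![a, h₁], ![a + b, h₂]] : Fin 2 → Pt) n t u ![2 * a + b, 0] := by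
    intro s hs
    apply pt_eq
    · simp [stMap_zero_coord]
      ring
    · simp only [stMap_pair_one_coord, Pi.add_apply, Pi.smul_apply, smul_eq_mul,
        Matrix.cons_val_zero, Matrix.cons_val_one, hma, hmb,
        max_eq_left (show 0 ≤ 2 * a + b - s - a by linarith),
        max_eq_left (show 0 ≤ 2 * a + b - s - (a + b) by linarith)]
      push_cast
      ring
  have top := H (-1) (1 - (n + u 0 + u 1)) isCoprime_one_left.neg_left
    ⟨a, ha, fun s hs0 hs => ⟨![2 * a + b - s, s],
      by refine ⟨?_, ?_, ?_, ?_⟩ <;> simp <;> linarith, heq s hs.le⟩⟩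
    (Or.inl fun q hq => by
      obtain ⟨q1, q2, q3, q4⟩ := hq
      simp only [stMap_pair_one_coord, Matrix.cons_val_zero, Matrix.cons_val_one, hma, hmb]
      push_cast
      rcases max_cases (q 0 - a) 0 with ⟨e, e'⟩ | ⟨e, e'⟩ <;>
      rcases max_cases (q 0 - (a + b)) 0 with ⟨f, f'⟩ | ⟨f, f'⟩ <;>
      rcases hu0 with g | g <;> rcases hu1 with k | k <;> rw [e, f, g, k] <;> linarith)
  have bot := H (-1) (-(n + u 0 + u 1)) isCoprime_one_left.neg_left
    ⟨a, ha, fun s hs0 hs => ⟨![2 * a + b - s, 0],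
      by refine ⟨?_, ?_, ?_, ?_⟩ <;> simp <;> linarith, by
      apply pt_eq
      · simp [stMap_zero_coord]
        ring
      · simp only [stMap_pair_one_coord, Pi.add_apply, Pi.smul_apply, smul_eq_mul,
          Matrix.cons_val_zero, Matrix.cons_val_one, hma, hmb,
          max_eq_left (show 0 ≤ 2 * a + b - s - a by linarith),
          max_eq_left (show 0 ≤ 2 * a + b - s - (a + b) by linarith)]
        push_cast
        ring⟩⟩
    (Or.inr fun q hq => by
      obtain ⟨q1, q2, q3, q4⟩ := hq
      simp only [stMap_pair_one_coord, Matrix.cons_val_zero, Matrix.cons_val_one, hma, hmb]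
      push_cast
      rcases max_cases (q 0 - a) 0 with ⟨e, e'⟩ | ⟨e, e'⟩ <;>
      rcases max_cases (q 0 - (a + b)) 0 with ⟨f, f'⟩ | ⟨f, f'⟩ <;>
      rcases hu0 with g | g <;> rcases hu1 with k | k <;> rw [e, f, g, k] <;> linarith)
  have key : ∀ s, 0 ≤ s → s < lam → s ≤ a := by
    intro s hs0 hs
    obtain ⟨q, hq, hqe⟩ := top s hs0 hs
    obtain ⟨q', hq', hqe'⟩ := bot s hs0 hs
    have e0 := congrFun hqe 0
    have e1 := congrFun hqe 1
    have f0 := congrFun hqe' 0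
    have f1 := congrFun hqe' 1
    simp only [Pi.add_apply, Pi.smul_apply, smul_eq_mul, stMap_zero_coord, stMap_pair_one_coord,
      Matrix.cons_val_zero, Matrix.cons_val_one] at e0 e1 f0 f1
    push_cast at e0 e1 f0 f1
    rw [f0] at f1
    rw [e0] at e1
    have := (hBsub hq).2.2.1
    have := (hBsub hq').1
    linarith
  refine ⟨le_of_forall_lt_imp_le_of_dense fun s hs => ?_, fun s hs0 hs => ?_⟩
  · rcases le_or_gt 0 s with h0 | h0
    · exact key s h0 hs
    · linarith
  · obtain ⟨q, hq, hqe⟩ := top s hs0 hs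
    convert hq using 1
    apply stMap_injective _ n t u
    rw [hqe, heq s (key s hs0 hs)]

end PackedTriangles

theorem measure_two_vertices_le {N : ℕ} {pt : Fin N → Pt} {lam : Fin N → ℝ} {tri : Fin N → Set Pt}
    (hinj : Function.Injective pt) (hlam : ∀ i, 0 < lam i)
    (hvol : ∀ i, volume (tri i) = ENNReal.ofReal (lam i ^ 2 / 2)) {v v' : Pt} {a : ℝ}
    (hv : ∀ i, pt i = v → lam i ≤ a) (hv' : ∀ i, pt i = v' → lam i ≤ a)
    (hvv' : ∀ i j, pt i = v → pt j = v' → lam i + lam j ≤ a) :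
    volume (⋃ (i) (_ : pt i = v), tri i) + volume (⋃ (i) (_ : pt i = v'), tri i) ≤
      ENNReal.ofReal (a ^ 2 / 2) := by
  have hsome : ∀ i, (⋃ (j) (_ : pt j = pt i), tri j) = tri i := by
    intro i
    ext x
    simp [hinj.eq_iff]
  have hnone : ∀ w, (¬ ∃ i, pt i = w) → (⋃ (j) (_ : pt j = w), tri j) = ∅ := by
    intro w hw
    push Not at hw
    simp [hw]
  by_cases h : ∃ i, pt i = v
  · obtain ⟨i, rfl⟩ := h
    rw [hsome, hvol]
    have hi := hlam i
    by_cases h' : ∃ j, pt j = v'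
    · obtain ⟨j, rfl⟩ := h'
      rw [hsome, hvol, ← ENNReal.ofReal_add (by positivity) (by positivity)]
      have hj := hlam j
      have := hvv' i j rfl rfl
      exact ENNReal.ofReal_le_ofReal (by nlinarith)
    · rw [hnone _ h', measure_empty, add_zero]
      have := hv i rfl
      exact ENNReal.ofReal_le_ofReal (by nlinarith)
  · rw [hnone _ h, measure_empty, zero_add]
    by_cases h' : ∃ j, pt j = v'
    · obtain ⟨j, rfl⟩ := h'
      rw [hsome, hvol]
      have hj := hlam j
      have := hv' j rfl
      exact ENNReal.ofReal_le_ofReal (by nlinarith)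
    · rw [hnone _ h', measure_empty]
      exact zero_le

theorem add_le_of_disjoint_segments {a l l' : ℝ} {B B' : Set Pt} (hl : 0 < l) (hla : l ≤ a)
    {f : ℝ → Pt} (hB : ∀ s, 0 ≤ s → s < l → f s ∈ B)
    (hB' : ∀ s, 0 ≤ s → s < l' → f (a - s) ∈ B') (hdisj : Disjoint B B') : l + l' ≤ a := by
  by_contra hcon
  push Not at hcon
  have h1 : max 0 (a - l') < l := max_lt hl (by linarith)
  obtain ⟨s, hs1, hs2⟩ := exists_between h1
  have h0 : 0 < s := (le_max_left _ _).trans_lt hs1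
  have h2 : a - l' < s := (le_max_right _ _).trans_lt hs1
  have := hB' (a - s) (by linarith) (by linarith)
  rw [sub_sub_cancel] at this
  exact disjoint_left.1 hdisj (hB s h0.le hs2) this

theorem volume_packing_le {a b h₁ h₂ : ℝ} (ha : 0 < a) (hb : 0 ≤ b) {P : Set Pt}
    (hP : IsSTPackingIn (convexHull ℝ {![0, 0], ![a, a], ![a + b, a], ![2 * a + b, 0]})
      (![![a, h₁], ![a + b, h₂]] : Fin 2 → Pt) (![1, 1] : Fin 2 → ℤ) P) :
    volume P ≤ ENNReal.ofReal (a ^ 2) := by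
  obtain ⟨N, pt, lam, tri, rfl, hinj, hext, hpack, hdisj⟩ := hP
  have hvert : ∀ i, pt i = ![0, 0] ∨ pt i = ![a, a] ∨ pt i = ![a + b, a] ∨
      pt i = ![2 * a + b, 0] := fun i => by
    simpa using extremePoints_convexHull_subset (hext i)
  rw [convexHull_eq_trapezoid ha hb] at hpack
  have hlam : ∀ i, 0 < lam i := fun i => (hpack i).1
  have hvol : ∀ i, volume (tri i) = ENNReal.ofReal (lam i ^ 2 / 2) := fun i => (hpack i).volume_eq
  have hbl := fun i (hi : pt i = ![0, 0]) => packed_bottom_left ha hb (hi ▸ hpack i)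
  have htl := fun i (hi : pt i = ![a, a]) => packed_top_left ha hb (hi ▸ hpack i)
  have htr := fun i (hi : pt i = ![a + b, a]) => packed_top_right ha hb (hi ▸ hpack i)
  have hbr := fun i (hi : pt i = ![2 * a + b, 0]) => packed_bottom_right ha hb (hi ▸ hpack i)
  have hne : ∀ {x y : ℝ} {i j : Fin N}, pt i = ![x, 0] → pt j = ![y, a] → i ≠ j := by
    rintro x y i j hi hj rfl
    have := congrFun (hi.symm.trans hj) 1
    simp at this
    exact ha.ne this
  have hleft := measure_two_vertices_le hinj hlam hvol (fun i hi => (hbl i hi).1)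
    (fun i hi => (htl i hi).1) (fun i j hi hj => add_le_of_disjoint_segments (hlam i) (hbl i hi).1
      (f := fun s => ![s, s]) (hbl i hi).2 (htl j hj).2 (hdisj (hne hi hj)))
  have hright := measure_two_vertices_le hinj hlam hvol (fun i hi => (hbr i hi).1)
    (fun i hi => (htr i hi).1) (fun i j hi hj => add_le_of_disjoint_segments (hlam i) (hbr i hi).1
      (f := fun s => ![2 * a + b - s, s]) (hbr i hi).2
      (fun s hs0 hs => by
        convert (htr j hj).2 s hs0 hs using 2
        ring) (hdisj (hne hi hj)))
  have hcover : (⋃ i, tri i) ⊆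
      ((⋃ (i) (_ : pt i = ![0, 0]), tri i) ∪ (⋃ (i) (_ : pt i = ![a, a]), tri i)) ∪
      ((⋃ (i) (_ : pt i = ![2 * a + b, 0]), tri i) ∪ (⋃ (i) (_ : pt i = ![a + b, a]), tri i)) := by
    refine iUnion_subset fun i x hx => ?_
    simp only [mem_union, mem_iUnion, exists_prop]
    rcases hvert i with h | h | h | h
    · exact Or.inl (Or.inl ⟨i, h, hx⟩)
    · exact Or.inl (Or.inr ⟨i, h, hx⟩)
    · exact Or.inr (Or.inr ⟨i, h, hx⟩)
    · exact Or.inr (Or.inl ⟨i, h, hx⟩)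
  calc volume (⋃ i, tri i) ≤ _ := measure_mono hcover
    _ ≤ _ := measure_union_le _ _
    _ ≤ _ := add_le_add ((measure_union_le _ _).trans hleft) ((measure_union_le _ _).trans hright)
    _ = ENNReal.ofReal (a ^ 2) := by
      rw [← ENNReal.ofReal_add (by positivity) (by positivity)]
      congr 1
      ring

theorem stMap_zero {m : ℕ} (c : Fin m → Pt) : stMap c 0 0 0 = id := by
  funext x
  apply pt_eq <;> simp [stMap]

theorem sl2Apply_mk_s15 (p q r s : ℤ) (h : (!![p, q; r, s]).det = 1) (x : Pt) :
    sl2Apply ⟨!![p, q; r, s], h⟩ x = ![p * x 0 + q * x 1, r * x 0 + s * x 1] := by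
  apply pt_eq
  · exact sl2Apply_zero_coord _ x
  · exact sl2Apply_one_coord _ x

/-- The triangle of size `a` at the left endpoint of the base of the trapezoid. -/
def leftTriangle (a : ℝ) : Set Pt := {x | 0 ≤ x 1 ∧ x 1 ≤ x 0 ∧ x 0 < a}

/-- The triangle of size `a` at the right endpoint of the base of the trapezoid. -/
def rightTriangle (a b : ℝ) : Set Pt := {x | 0 ≤ x 1 ∧ a + b < x 0 ∧ x 0 + x 1 ≤ 2 * a + b}

theorem leftTriangle_packed {a b h₁ h₂ : ℝ} (ha : 0 < a) (hb : 0 ≤ b) :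
    IsSTPackedTriangleIn (trapezoid a b) (![![a, h₁], ![a + b, h₂]] : Fin 2 → Pt)
      (![1, 1] : Fin 2 → ℤ) ![0, 0] a (leftTriangle a) := by
  refine ⟨ha, ?_, ?_, 0, 0, 0, fun j => Or.inl rfl, ⟨⟨!![1, 1; 0, 1], by simp⟩, ?_⟩,
    {x | x 0 < a}, ?_, ?_, ?_⟩
  · rintro x ⟨h1, h2, h3⟩
    refine ⟨h1, h2, by linarith, by linarith⟩
  · intro j
    fin_cases j
    · simp [leftTriangle]
    · simp [leftTriangle, hb]
  · rw [stMap_zero, image_id]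
    simp only [id]
    ext x
    constructor
    · rintro ⟨h1, h2, h3⟩
      refine ⟨![x 0 - x 1, x 1], ⟨by simpa using h2, by simpa using h1, by simpa using h3⟩, ?_⟩
      apply pt_eq
      · simp [sl2Apply_mk_s15]
      · simp [sl2Apply_mk_s15]
    · rintro ⟨y, ⟨h1, h2, h3⟩, rfl⟩
      refine ⟨?_, ?_, ?_⟩ <;> simp [sl2Apply_mk_s15] <;> linarith
  · exact isOpen_lt (by fun_prop) continuous_const
  · simpa [stMap_zero] using ha
  · simp only [stMap_zero, image_id]
    ext x
    constructor
    · rintro ⟨⟨h1, h2, h3⟩, h4⟩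
      exact ⟨⟨h1, h2, by linarith, by linarith⟩, h4⟩
    · rintro ⟨⟨h1, h2, h3, h5⟩, h4⟩
      exact ⟨⟨h1, h2, h4⟩, h4⟩

theorem rightTriangle_packed {a b h₁ h₂ : ℝ} (ha : 0 < a) (hb : 0 ≤ b) :
    IsSTPackedTriangleIn (trapezoid a b) (![![a, h₁], ![a + b, h₂]] : Fin 2 → Pt)
      (![1, 1] : Fin 2 → ℤ) ![2 * a + b, 0] a (rightTriangle a b) := by
  refine ⟨ha, ?_, ?_, 0, 0, 0, fun j => Or.inl rfl, ⟨⟨!![-1, -1; 1, 0], by simp⟩, ?_⟩,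
    {x | a + b < x 0}, ?_, ?_, ?_⟩
  · rintro x ⟨h1, h2, h3⟩
    refine ⟨h1, by linarith, by linarith, by linarith⟩
  · intro j
    fin_cases j
    · simp [rightTriangle, hb.not_gt]
    · simp [rightTriangle]
  · rw [stMap_zero, image_id]
    simp only [id]
    ext x
    constructor
    · rintro ⟨h1, h2, h3⟩
      refine ⟨![x 1, 2 * a + b - x 0 - x 1], ⟨by simpa using h1, ?_, ?_⟩, ?_⟩
      · simp
        linarith
      · simp
        linarith
      apply pt_eq
      · simp [sl2Apply_mk_s15]
        ring
      · simp [sl2Apply_mk_s15]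
    · rintro ⟨y, ⟨h1, h2, h3⟩, rfl⟩
      refine ⟨?_, ?_, ?_⟩ <;> simp [sl2Apply_mk_s15] <;> linarith
  · exact isOpen_lt continuous_const (by fun_prop)
  · simp [stMap_zero]
    linarith
  · simp only [stMap_zero, image_id]
    ext x
    constructor
    · rintro ⟨⟨h1, h2, h3⟩, h4⟩
      exact ⟨⟨h1, by linarith, by linarith, by linarith⟩, h4⟩
    · rintro ⟨⟨h1, h2, h3, h5⟩, h4⟩
      exact ⟨⟨h1, h4, h5⟩, h4⟩

theorem disjoint_leftTriangle_rightTriangle {a b : ℝ} (hb : 0 ≤ b) :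
    Disjoint (leftTriangle a) (rightTriangle a b) := by
  rw [disjoint_left]
  rintro x ⟨-, -, h⟩ ⟨-, h', -⟩
  linarith

theorem measurableSet_rightTriangle (a b : ℝ) : MeasurableSet (rightTriangle a b) := by
  unfold rightTriangle
  measurability

theorem volume_leftTriangle_union_rightTriangle {a b : ℝ} (ha : 0 < a) (hb : 0 ≤ b) :
    volume (leftTriangle a ∪ rightTriangle a b) = ENNReal.ofReal (a ^ 2) := by
  rw [measure_union (disjoint_leftTriangle_rightTriangle hb) (measurableSet_rightTriangle a b),
    (leftTriangle_packed (h₁ := 0) (h₂ := 0) ha hb).volume_eq,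
    (rightTriangle_packed (h₁ := 0) (h₂ := 0) ha hb).volume_eq,
    ← ENNReal.ofReal_add (by positivity) (by positivity)]
  congr 1
  ring

theorem volume_trapezoid {a b : ℝ} (ha : 0 < a) (hb : 0 ≤ b) :
    volume (trapezoid a b) = ENNReal.ofReal (a * (a + b)) := by
  have hsplit : trapezoid a b =
      (leftTriangle a ∪ rightTriangle a b) ∪ Icc ![a, 0] ![a + b, a] := by
    ext x
    simp only [trapezoid, leftTriangle, rightTriangle, mem_union, mem_ofPred_eq, mem_Icc,
      Pi.le_def, Fin.forall_fin_two, Matrix.cons_val_zero, Matrix.cons_val_one]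
    constructor
    · rintro ⟨h1, h2, h3, h4⟩
      by_cases hl : x 0 < a
      · exact Or.inl (Or.inl ⟨h1, h2, hl⟩)
      · by_cases hr : a + b < x 0
        · exact Or.inl (Or.inr ⟨h1, hr, h4⟩)
        · exact Or.inr ⟨⟨not_lt.1 hl, h1⟩, not_lt.1 hr, h3⟩
    · rintro ((⟨h1, h2, h3⟩ | ⟨h1, h2, h3⟩) | ⟨⟨h1, h2⟩, h3, h4⟩) <;>
        refine ⟨?_, ?_, ?_, ?_⟩ <;> linarith
  have hdisj : Disjoint (leftTriangle a ∪ rightTriangle a b) (Icc ![a, 0] ![a + b, a]) := by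
    rw [disjoint_left]
    rintro x (⟨-, -, h⟩ | ⟨-, h, -⟩) ⟨h1, h2⟩
    · have := h1 0
      simp at this
      linarith
    · have := h2 0
      simp at this
      linarith
  rw [hsplit, measure_union hdisj measurableSet_Icc,
    volume_leftTriangle_union_rightTriangle ha hb, Real.volume_Icc_pi, Fin.prod_univ_two]
  simp only [Matrix.cons_val_zero, Matrix.cons_val_one, add_sub_cancel_left, sub_zero]
  rw [← ENNReal.ofReal_mul hb, ← ENNReal.ofReal_add (by positivity) (by positivity)]
  congr 1
  ring

theorem bottom_left_mem_extremePoints {a b : ℝ} (ha : 0 < a) (hb : 0 ≤ b) :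
    ![0, 0] ∈ extremePoints ℝ (trapezoid a b) := by
  refine mem_extremePoints_iff_left.2
    ⟨by refine ⟨?_, ?_, ?_, ?_⟩ <;> simp <;> linarith, ?_⟩
  rintro x ⟨h1, h2, -, -⟩ y ⟨h1', h2', -, -⟩ ⟨s, t, hs, ht, -, hxy⟩
  have e0 := congrFun hxy 0
  simp only [Pi.add_apply, Pi.smul_apply, smul_eq_mul, Matrix.cons_val_zero] at e0
  have hx0 : x 0 = 0 := by nlinarith [mul_nonneg ht.le (h1'.trans h2'), h1.trans h2]
  exact pt_eq hx0 (by simp; linarith)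

theorem bottom_right_mem_extremePoints {a b : ℝ} (ha : 0 < a) (hb : 0 ≤ b) :
    ![2 * a + b, 0] ∈ extremePoints ℝ (trapezoid a b) := by
  refine mem_extremePoints_iff_left.2
    ⟨by refine ⟨?_, ?_, ?_, ?_⟩ <;> simp <;> linarith, ?_⟩
  rintro x ⟨h1, -, -, h2⟩ y ⟨h1', -, -, h2'⟩ ⟨s, t, hs, ht, hst, hxy⟩
  obtain rfl : t = 1 - s := by linarith
  have e0 := congrFun hxy 0
  simp only [Pi.add_apply, Pi.smul_apply, smul_eq_mul, Matrix.cons_val_zero] at e0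
  have hy0 : 0 ≤ (1 - s) * (2 * a + b - y 0) := mul_nonneg ht.le (by linarith)
  have hx0 : x 0 = 2 * a + b := by nlinarith
  exact pt_eq hx0 (by simp; linarith)

theorem isSTPackingIn_leftTriangle_union_rightTriangle {a b h₁ h₂ : ℝ} (ha : 0 < a)
    (hb : 0 ≤ b) :
    IsSTPackingIn (trapezoid a b) (![![a, h₁], ![a + b, h₂]] : Fin 2 → Pt)
      (![1, 1] : Fin 2 → ℤ) (leftTriangle a ∪ rightTriangle a b) := by
  refine ⟨2, ![![0, 0], ![2 * a + b, 0]], fun _ => a, ![leftTriangle a, rightTriangle a b],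
    ?_, ?_, ?_, ?_, ?_⟩
  · ext x
    simp [Fin.exists_fin_two]
  · have hne : (![0, 0] : Pt) ≠ ![2 * a + b, 0] := by
      intro h
      have := congrFun h 0
      simp at this
      linarith
    intro i j hij
    fin_cases i <;> fin_cases j
    · rfl
    · exact absurd hij hne
    · exact absurd hij.symm hne
    · rfl
  · exact Fin.forall_fin_two.2
      ⟨bottom_left_mem_extremePoints ha hb, bottom_right_mem_extremePoints ha hb⟩
  · exact Fin.forall_fin_two.2 ⟨leftTriangle_packed ha hb, rightTriangle_packed ha hb⟩
  · have hd := disjoint_leftTriangle_rightTriangle (a := a) hb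
    intro i j hij
    fin_cases i <;> fin_cases j
    · exact absurd rfl hij
    · exact hd
    · exact hd.symm
    · exact absurd rfl hij

theorem isGreatest_stDensitySet_trapezoid {a b h₁ h₂ : ℝ} (ha : 0 < a) (hb : 0 ≤ b) :
    IsGreatest
      (stDensitySet
        (convexHull ℝ {![0, 0], ![a, a], ![a + b, a], ![2 * a + b, 0]})
        (![![a, h₁], ![a + b, h₂]] : Fin 2 → Pt) (![1, 1] : Fin 2 → ℤ))
      (a / (a + b)) := by
  have hab : 0 < a + b := by linarith
  have harea : area (convexHull ℝ {![0, 0], ![a, a], ![a + b, a], ![2 * a + b, 0]}) =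
      a * (a + b) := by
    rw [area, convexHull_eq_trapezoid ha hb, volume_trapezoid ha hb,
      ENNReal.toReal_ofReal (by positivity)]
  have hratio : a / (a + b) = a ^ 2 / (a * (a + b)) := by
    field_simp
  constructor
  · refine ⟨leftTriangle a ∪ rightTriangle a b, ?_, ?_⟩
    · rw [convexHull_eq_trapezoid ha hb]
      exact isSTPackingIn_leftTriangle_union_rightTriangle ha hb
    · rw [harea, area, volume_leftTriangle_union_rightTriangle ha hb,
        ENNReal.toReal_ofReal (by positivity), hratio]
  · rintro r ⟨P, hP, rfl⟩
    rw [harea, hratio]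
    gcongr
    exact ENNReal.toReal_le_of_le_ofReal (by positivity) (volume_packing_le ha hb hP)

/-- The minimal semitoric polygon of type (2) — with vertices `(0,0)`,
`(a,a)`, `(a+b,a)`, `(2a+b,0)`, marked points `(a,h₁)` and `(a+b,h₂)` with
`0 < h₁, h₂ < a`, and upward cuts — has semitoric packing density `ρ_ST = a/(a+b)`;
in particular it is independent of `h₁, h₂` and equals `1` when `b = 0`. -/
theorem stmt15 (a b h₁ h₂ : ℝ) (ha : 0 < a) (hb : 0 ≤ b)
    (hh₁0 : 0 < h₁) (hh₁a : h₁ < a) (hh₂0 : 0 < h₂) (hh₂a : h₂ < a) :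
    IsLUB
      (stDensitySet
        (convexHull ℝ {![0, 0], ![a, a], ![a + b, a], ![2 * a + b, 0]})
        (![![a, h₁], ![a + b, h₂]] : Fin 2 → Pt) (![1, 1] : Fin 2 → ℤ))
      (a / (a + b)) ∧
    (b = 0 → IsLUB
      (stDensitySet
        (convexHull ℝ {![0, 0], ![a, a], ![a + b, a], ![2 * a + b, 0]})
        (![![a, h₁], ![a + b, h₂]] : Fin 2 → Pt) (![1, 1] : Fin 2 → ℤ))
      1) := by
  have h := (isGreatest_stDensitySet_trapezoid (h₁ := h₁) (h₂ := h₂) ha hb).isLUB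
  refine ⟨h, fun hb0 => ?_⟩
  have hone : a / (a + b) = 1 := by rw [hb0, add_zero, div_self ha.ne']
  rwa [hone] at h
end
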